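/- arXiv:2008.09406 — 3 statements merged into one kernel-verified Lean document; each statement's English description precedes it below -/
import Mathlib

section
/- Let $\pi$ be a curve in $\mathbb{R}$ with $\delta$-signature $\sigma_\pi$ having vertices $\pi(p_1), \ldots, \pi(p_\ell)$, and let $\tau$ be a curve in $\mathbb{R}$ with vertices $\tau(t_1), \ldots, \tau(t_k)$. Fix $w > 0$ and let $z$ be uniform on $[0,w]$; set $g_{w,z}(x) = \lfloor (x-z)/w \rfloor$. Define $\sigma_\pi' = \langle g_{w,z}(\pi(p_1)), \ldots, g_{w,z}(\pi(p_\ell)) \rangle$ and $\tau' = \langle g_{w,z}(\tau(t_1)), \ldots, g_{w,z}(\tau(t_k)) \rangle$. If $d_F(\pi, \tau) \le \delta$, then the probability that the vertex sequences (sequences of local extrema) of $\sigma_\pi'$ and $\tau'$ differ is at most $6k\delta / w$. -/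
open Set

/-- Continuous Fréchet distance between two curves parametrized on `[0,1]`. -/
noncomputable def frechetDist {E : Type*} [PseudoMetricSpace E] (f g : ℝ → E) : ℝ :=
  sInf { r : ℝ | ∃ φ ψ : ℝ → ℝ,
    ContinuousOn φ (Set.Icc 0 1) ∧ ContinuousOn ψ (Set.Icc 0 1) ∧
    MonotoneOn φ (Set.Icc 0 1) ∧ MonotoneOn ψ (Set.Icc 0 1) ∧
    φ 0 = 0 ∧ φ 1 = 1 ∧ ψ 0 = 0 ∧ ψ 1 = 1 ∧
    ∀ t ∈ Set.Icc (0:ℝ) 1, dist (f (φ t)) (g (ψ t)) ≤ r }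

/-- The directed line segment from `a` to `b` as a curve on `[0,1]`. -/
def seg {E : Type*} [AddCommGroup E] [Module ℝ E] (a b : E) : ℝ → E :=
  fun s => (1 - s) • a + s • b

/-- Polygonal curve with vertices `p 0, …, p n`, parametrized on `[0,1]`. -/
noncomputable def polyline {E : Type*} [AddCommGroup E] [Module ℝ E] {n : ℕ}
    (p : Fin (n + 1) → E) (s : ℝ) : E :=
  let u : ℝ := s * n
  let i : ℕ := min ⌊u⌋₊ (n - 1)
  (1 - (u - i)) • p ⟨min i n, Nat.lt_succ_of_le (Nat.min_le_right _ _)⟩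
    + (u - i) • p ⟨min (i + 1) n, Nat.lt_succ_of_le (Nat.min_le_right _ _)⟩

/-- Polygonal curve through the points of a list. -/
noncomputable def polylineL {E : Type*} [AddCommGroup E] [Module ℝ E] (l : List E) : ℝ → E :=
  polyline (n := l.length - 1) (fun i => l.getD i.val 0)

/-- `τ` restricted to `[0,1]` is the polygonal curve with vertices
`τ (t 0), …, τ (t m)` at parameters `0 = t 0 < ⋯ < t m = 1`. -/
def IsPolylineOn (τ : ℝ → ℝ) (m : ℕ) (t : ℕ → ℝ) : Prop :=
  t 0 = 0 ∧ t m = 1 ∧ (∀ i < m, t i < t (i + 1)) ∧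
  ∀ i < m, ∀ s, t i ≤ s → s ≤ t (i + 1) →
    τ s = τ (t i) + (s - t i) / (t (i + 1) - t i) * (τ (t (i + 1)) - τ (t i))

/-- `s` is the parameter of a vertex (local extremum) of the time series `τ`. -/
def VertexAt (τ : ℝ → ℝ) (s : ℝ) : Prop :=
  s ∈ Set.Icc (0:ℝ) 1 ∧
    (IsLocalMaxOn τ (Set.Icc 0 1) s ∨ IsLocalMinOn τ (Set.Icc 0 1) s)

/-- A `δ`-signature of `τ : [0,1] → ℝ`, given by parameters
`0 = t 0 < t 1 < ⋯ < t ℓ = 1` (so the signature has `ℓ + 1` vertices and `ℓ ≥ 1` edges);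
the signature curve itself is `polyline (fun i => τ (t i))`. -/
structure IsDeltaSignature (δ : ℝ) (τ : ℝ → ℝ) (ℓ : ℕ) (t : ℕ → ℝ) : Prop where
  one_le : 1 ≤ ℓ
  mono : ∀ i < ℓ, t i < t (i + 1)
  start : t 0 = 0
  finish : t ℓ = 1
  nondeg : ∀ i, 1 ≤ i → i < ℓ →
    τ (t i) ∉ Set.uIcc (τ (t (i - 1))) (τ (t (i + 1)))
  dir_up : ∀ i < ℓ, τ (t i) < τ (t (i + 1)) →
    ∀ a b, t i ≤ a → a ≤ b → b ≤ t (i + 1) → τ a - τ b ≤ 2 * δ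
  dir_down : ∀ i < ℓ, τ (t (i + 1)) < τ (t i) →
    ∀ a b, t i ≤ a → a ≤ b → b ≤ t (i + 1) → τ b - τ a ≤ 2 * δ
  minedge_int : ∀ i, 1 ≤ i → i ≤ ℓ - 2 → 2 * δ < |τ (t (i + 1)) - τ (t i)|
  minedge_bnd : ∀ i < ℓ, (i = 0 ∨ i = ℓ - 1) → δ < |τ (t (i + 1)) - τ (t i)|
  range_int : ∀ i, 1 ≤ i → i ≤ ℓ - 2 → ∀ s, t i ≤ s → s ≤ t (i + 1) →
    τ s ∈ Set.uIcc (τ (t i)) (τ (t (i + 1)))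
  range_first : 2 ≤ ℓ → ∀ s, t 0 ≤ s → s ≤ t 1 →
    τ s ∈ Set.uIcc (τ (t 0)) (τ (t 1)) ∪ Set.Icc (τ (t 0) - δ) (τ (t 0) + δ)
  range_last : 2 ≤ ℓ → ∀ s, t (ℓ - 1) ≤ s → s ≤ t ℓ →
    τ s ∈ Set.uIcc (τ (t (ℓ - 1))) (τ (t ℓ)) ∪ Set.Icc (τ (t ℓ) - δ) (τ (t ℓ) + δ)
  range_single : ℓ = 1 → ∀ s, (0:ℝ) ≤ s → s ≤ 1 →
    τ s ∈ Set.uIcc (τ (t 0)) (τ (t 1)) ∪ Set.Icc (τ (t 0) - δ) (τ (t 0) + δ)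
      ∪ Set.Icc (τ (t 1) - δ) (τ (t 1) + δ)

/-- One step of a traversal: each index advances by 0 or 1, at least one advances. -/
def TravStep (a b : ℕ × ℕ) : Prop :=
  a.1 ≤ b.1 ∧ b.1 ≤ a.1 + 1 ∧ a.2 ≤ b.2 ∧ b.2 ≤ a.2 + 1 ∧ a ≠ b

/-- A traversal of two point sequences of lengths `m` and `k` (0-based indices). -/
def IsTraversal (m k : ℕ) (T : List (ℕ × ℕ)) : Prop :=
  T.head? = some (0, 0) ∧ T.getLast? = some (m - 1, k - 1) ∧ List.Chain' TravStep T

/-- Discrete Fréchet distance between the point sequences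
`p 0, …, p (m-1)` and `q 0, …, q (k-1)`. -/
noncomputable def ddF {E : Type*} [PseudoMetricSpace E] (m k : ℕ) (p q : ℕ → E) : ℝ :=
  sInf { r : ℝ | ∃ T : List (ℕ × ℕ), IsTraversal m k T ∧
    ∀ ij ∈ T, dist (p ij.1) (q ij.2) ≤ r }

/-- The subsequence of local extrema (vertex sequence) of a list of values. -/
def vertexSeq {α : Type*} [LinearOrder α] : List α → List α
  | [] => []
  | [a] => [a]
  | [a, b] => [a, b]
  | a :: b :: c :: rest =>
    if (a ≤ b ∧ b ≤ c) ∨ (c ≤ b ∧ b ≤ a) then vertexSeq (a :: c :: rest)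
    else a :: vertexSeq (b :: c :: rest)
termination_by l => l.length

theorem vertexSeq_cons_cons_cons {α : Type*} [LinearOrder α] (a b c : α) (l : List α) :
    vertexSeq (a :: b :: c :: l) =
      if (a ≤ b ∧ b ≤ c) ∨ (c ≤ b ∧ b ≤ a) then vertexSeq (a :: c :: l)
      else a :: vertexSeq (b :: c :: l) := by
  rw [vertexSeq]

/-- A value lying between its two neighbours does not contribute to the vertex sequence. -/
theorem vertexSeq_append_between {α : Type*} [LinearOrder α] {a b c : α}
    (h : (a ≤ b ∧ b ≤ c) ∨ (c ≤ b ∧ b ≤ a)) (l₂ : List α) :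
    ∀ l₁ : List α, vertexSeq (l₁ ++ a :: b :: c :: l₂) = vertexSeq (l₁ ++ a :: c :: l₂)
  | [] => by
    rw [List.nil_append, vertexSeq_cons_cons_cons, if_pos h, List.nil_append]
  | [x] => by
    have h₁ := vertexSeq_cons_cons_cons x a b (c :: l₂)
    have h₂ := vertexSeq_cons_cons_cons x a c l₂
    have h₃ := vertexSeq_cons_cons_cons a b c l₂
    have h₄ := vertexSeq_cons_cons_cons x b c l₂
    simp only [List.cons_append, List.nil_append]
    grind
  | [x, y] => by
    have ih := vertexSeq_append_between h l₂ [x]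
    have ih' := vertexSeq_append_between h l₂ [y]
    simp only [List.cons_append, List.nil_append] at ih ih' ⊢
    rw [vertexSeq_cons_cons_cons, vertexSeq_cons_cons_cons x y a, ih, ih']
  | x :: y :: z :: l => by
    have ih := vertexSeq_append_between h l₂ (x :: z :: l)
    have ih' := vertexSeq_append_between h l₂ (y :: z :: l)
    simp only [List.cons_append] at ih ih' ⊢
    rw [vertexSeq_cons_cons_cons, vertexSeq_cons_cons_cons x y z, ih, ih']
  termination_by l₁ => l₁.length

theorem vertexSeq_map_sort_insert {α : Type*} [LinearOrder α] (h : ℝ → α) (S : Finset ℝ) (x : ℝ)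
    (hx : x ∉ S) {a b : ℝ} (ha : a ∈ S) (hb : b ∈ S) (hax : a < x) (hxb : x < b)
    (hh : MonotoneOn h (↑(insert x S) ∩ Icc a b) ∨ AntitoneOn h (↑(insert x S) ∩ Icc a b)) :
    vertexSeq ((insert x S).sort.map h) = vertexSeq (S.sort.map h) := by
  obtain ⟨a', l₁, ha'⟩ : ∃ a' l₁, (S.filter (· < x)).sort (· ≤ ·) = l₁ ++ [a'] := by
    rcases List.eq_nil_or_concat ((S.filter (· < x)).sort (· ≤ ·)) with h0 | ⟨l, y, hl⟩
    · have : a ∈ (S.filter (· < x)).sort (· ≤ ·) := by simp [ha, hax]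
      simp [h0] at this
    · exact ⟨y, l, by simpa using hl⟩
  obtain ⟨c, l₂, hc⟩ : ∃ c l₂, (S.filter (x < ·)).sort (· ≤ ·) = c :: l₂ := by
    rcases hl : (S.filter (x < ·)).sort (· ≤ ·) with _ | ⟨y, l⟩
    · have : b ∈ (S.filter (x < ·)).sort (· ≤ ·) := by simp [hb, hxb]
      simp [hl] at this
    · exact ⟨y, l, rfl⟩
  have sA := ((S.filter (· < x)).sortedLT_sort).pairwise
  have sB := ((S.filter (x < ·)).sortedLT_sort).pairwise
  have mA : ∀ y, y ∈ l₁ ++ [a'] ↔ y ∈ S ∧ y < x := by intro y; rw [← ha']; simp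
  have mB : ∀ y, y ∈ c :: l₂ ↔ y ∈ S ∧ x < y := by intro y; rw [← hc]; simp
  rw [ha'] at sA
  rw [hc] at sB
  have e₁ : S.sort = (l₁ ++ [a']) ++ c :: l₂ := by
    refine S.sortedLT_sort.eq_of_mem_iff (List.Pairwise.sortedLT ?_) ?_
    · refine List.pairwise_append.2 ⟨sA, sB, fun y hy z hz => ?_⟩
      exact ((mA y).1 hy).2.trans ((mB z).1 hz).2
    · intro y
      rw [List.mem_append, mA, mB, Finset.mem_sort]
      rcases lt_trichotomy y x with h | h | h <;> grind
  have e₂ : (insert x S).sort = (l₁ ++ [a']) ++ x :: c :: l₂ := by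
    refine (insert x S).sortedLT_sort.eq_of_mem_iff (List.Pairwise.sortedLT ?_) ?_
    · refine List.pairwise_append.2 ⟨sA, List.pairwise_cons.2 ⟨fun z hz => ((mB z).1 hz).2, sB⟩,
        fun y hy z hz => ?_⟩
      rcases List.mem_cons.1 hz with rfl | hz
      · exact ((mA y).1 hy).2
      · exact ((mA y).1 hy).2.trans ((mB z).1 hz).2
    · intro y
      rw [List.mem_append, List.mem_cons, mA, mB, Finset.mem_sort, Finset.mem_insert]
      rcases lt_trichotomy y x with h | h | h <;> grind
  have ha'S := (mA a').1 (by simp)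
  have hcS := (mB c).1 (by simp)
  have haa' : a ≤ a' := by
    have := (mA a).2 ⟨ha, hax⟩
    rcases List.mem_append.1 this with h | h
    · exact ((List.pairwise_append.1 sA).2.2 a h a' (by simp)).le
    · exact (List.mem_singleton.1 h).le
  have hcb : c ≤ b := by
    have := (mB b).2 ⟨hb, hxb⟩
    rcases List.mem_cons.1 this with h | h
    · exact h.ge
    · exact ((List.pairwise_cons.1 sB).1 b h).le
  have ma : a' ∈ (↑(insert x S) ∩ Icc a b : Set ℝ) :=
    ⟨by simp [ha'S.1], haa', ha'S.2.le.trans hxb.le⟩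
  have mx : x ∈ (↑(insert x S) ∩ Icc a b : Set ℝ) := ⟨by simp, hax.le, hxb.le⟩
  have mc : c ∈ (↑(insert x S) ∩ Icc a b : Set ℝ) :=
    ⟨by simp [hcS.1], hax.le.trans hcS.2.le, hcb⟩
  rw [e₁, e₂]
  simp only [List.map_append, List.map_cons, List.append_assoc, List.cons_append,
    List.nil_append]
  refine vertexSeq_append_between ?_ _ _
  rcases hh with hh | hh
  · exact .inl ⟨hh ma mx ha'S.2.le, hh mx mc hcS.2.le⟩
  · exact .inr ⟨hh mx mc hcS.2.le, hh ma mx ha'S.2.le⟩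

/-- Refining a sampling set monotonically between its points keeps the vertex sequence. -/
theorem vertexSeq_map_sort_of_subset {α : Type*} [LinearOrder α] (h : ℝ → α) (S : Finset ℝ) :
    ∀ (n : ℕ) (T : Finset ℝ), S ⊆ T → (T \ S).card = n →
      (∀ x ∈ T, x ∉ S → ∃ a ∈ S, ∃ b ∈ S, a < x ∧ x < b ∧
        (MonotoneOn h (↑T ∩ Icc a b) ∨ AntitoneOn h (↑T ∩ Icc a b))) →
      vertexSeq (T.sort.map h) = vertexSeq (S.sort.map h) := by
  intro n
  induction n with
  | zero =>
    intro T hST hn _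
    rw [Finset.card_eq_zero, Finset.sdiff_eq_empty_iff_subset] at hn
    rw [hST.antisymm hn]
  | succ n ih =>
    intro T hST hn hT
    obtain ⟨x, hx⟩ : (T \ S).Nonempty := Finset.card_pos.1 (by omega)
    obtain ⟨hxT, hxS⟩ := Finset.mem_sdiff.1 hx
    have hST' : S ⊆ T.erase x := fun y hy =>
      Finset.mem_erase.2 ⟨fun e => hxS (e ▸ hy), hST hy⟩
    have hsub : (↑(T.erase x) : Set ℝ) ⊆ ↑T := by
      exact_mod_cast Finset.erase_subset x T
    rw [← ih (T.erase x) hST' ?_ ?_]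
    · obtain ⟨a, ha, b, hb, hax, hxb, hh⟩ := hT x hxT hxS
      have := vertexSeq_map_sort_insert h (T.erase x) x (Finset.notMem_erase x T) (hST' ha)
        (hST' hb) hax hxb
      rw [Finset.insert_erase hxT] at this
      exact this hh
    · rw [Finset.erase_sdiff_comm, Finset.card_erase_of_mem hx, hn]
      rfl
    · intro y hy hyS
      obtain ⟨a, ha, b, hb, hay, hyb, hh⟩ := hT y (Finset.mem_of_mem_erase hy) hyS
      exact ⟨a, ha, b, hb, hay, hyb,
        hh.imp (fun h => h.mono (inter_subset_inter_left _ hsub))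
          (fun h => h.mono (inter_subset_inter_left _ hsub))⟩

theorem exists_step_mem_Icc {u : ℕ → ℝ} {n : ℕ} (hn : 1 ≤ n) {x : ℝ} (h0 : u 0 ≤ x)
    (h1 : x ≤ u n) : ∃ i < n, u i ≤ x ∧ x ≤ u (i + 1) := by
  induction n, hn using Nat.le_induction with
  | base => exact ⟨0, one_pos, h0, h1⟩
  | succ n _ ih =>
    rcases le_total x (u n) with h | h
    · obtain ⟨i, hi, hx⟩ := ih h
      exact ⟨i, by omega, hx⟩
    · exact ⟨n, by omega, h, h1⟩

theorem sort_image_range {u : ℕ → ℝ} {n : ℕ} (hu : StrictMonoOn u (Set.Iic n)) :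
    ((Finset.range (n + 1)).image u).sort = (List.range (n + 1)).map u := by
  refine (Finset.sortedLT_sort _).eq_of_mem_iff (List.Pairwise.sortedLT ?_) (by simp)
  rw [List.pairwise_map]
  refine (List.pairwise_lt_range (n := n + 1)).imp_of_mem fun {a b} ha hb hab => ?_
  rw [List.mem_range] at ha hb
  exact hu (Set.mem_Iic.2 (by omega)) (Set.mem_Iic.2 (by omega)) hab

theorem vertexSeq_map_sort_eq_map_range {α : Type*} [LinearOrder α] (h : ℝ → α) {u : ℕ → ℝ} {n : ℕ}
    (hn : 1 ≤ n) (hu : StrictMonoOn u (Set.Iic n)) (T : Finset ℝ)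
    (hT : ∀ i ≤ n, u i ∈ T) (hT' : ∀ x ∈ T, u 0 ≤ x ∧ x ≤ u n)
    (hh : ∀ i < n, MonotoneOn h (↑T ∩ Icc (u i) (u (i + 1))) ∨
      AntitoneOn h (↑T ∩ Icc (u i) (u (i + 1)))) :
    vertexSeq (T.sort.map h) = vertexSeq ((List.range (n + 1)).map fun i => h (u i)) := by
  have e : ((List.range (n + 1)).map fun i => h (u i)) =
      ((Finset.range (n + 1)).image u).sort.map h := by
    rw [sort_image_range hu, List.map_map]
    rfl
  rw [e]
  have mem : ∀ i ≤ n, u i ∈ (Finset.range (n + 1)).image u := fun i hi =>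
    Finset.mem_image_of_mem _ (by simp; omega)
  refine vertexSeq_map_sort_of_subset h _ _ T ?_ rfl ?_
  · intro x hx
    obtain ⟨i, hi, rfl⟩ := Finset.mem_image.1 hx
    exact hT i (by simp at hi; omega)
  · intro x hx hxS
    obtain ⟨i, hi, h₁, h₂⟩ := exists_step_mem_Icc hn (hT' x hx).1 (hT' x hx).2
    refine ⟨u i, mem i hi.le, u (i + 1), mem _ hi, lt_of_le_of_ne h₁ ?_, lt_of_le_of_ne h₂ ?_,
      hh i hi⟩
    · rintro rfl
      exact hxS (mem i hi.le)
    · rintro rfl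
      exact hxS (mem _ hi)

theorem IsPolylineOn.strictMonoOn {τ : ℝ → ℝ} {m : ℕ} {t : ℕ → ℝ} (h : IsPolylineOn τ m t) :
    StrictMonoOn t (Set.Iic m) :=
  strictMonoOn_Iic_of_lt_succ h.2.2.1

theorem IsPolylineOn.one_le {τ : ℝ → ℝ} {m : ℕ} {t : ℕ → ℝ} (h : IsPolylineOn τ m t) : 1 ≤ m := by
  rcases Nat.eq_zero_or_pos m with rfl | hm
  · have := h.1.symm.trans h.2.1
    norm_num at this
  · exact hm

theorem IsPolylineOn.neg {τ : ℝ → ℝ} {m : ℕ} {t : ℕ → ℝ} (h : IsPolylineOn τ m t) :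
    IsPolylineOn (fun s => -τ s) m t := by
  refine ⟨h.1, h.2.1, h.2.2.1, fun i hi s h₁ h₂ => ?_⟩
  have := h.2.2.2 i hi s h₁ h₂
  linear_combination -this

theorem IsPolylineOn.monotoneOn {τ : ℝ → ℝ} {m : ℕ} {t : ℕ → ℝ} (h : IsPolylineOn τ m t) {i : ℕ}
    (hi : i < m) (hle : τ (t i) ≤ τ (t (i + 1))) : MonotoneOn τ (Icc (t i) (t (i + 1))) := by
  intro x hx y hy hxy
  rw [h.2.2.2 i hi x hx.1 hx.2, h.2.2.2 i hi y hy.1 hy.2]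
  have := h.2.2.1 i hi
  gcongr

theorem IsPolylineOn.antitoneOn {τ : ℝ → ℝ} {m : ℕ} {t : ℕ → ℝ} (h : IsPolylineOn τ m t) {i : ℕ}
    (hi : i < m) (hle : τ (t (i + 1)) ≤ τ (t i)) : AntitoneOn τ (Icc (t i) (t (i + 1))) := by
  intro x hx y hy hxy
  simpa using h.neg.monotoneOn hi (by simpa using hle) hx hy hxy

theorem IsPolylineOn.exists_abs_le {τ : ℝ → ℝ} {m : ℕ} {t : ℕ → ℝ} (h : IsPolylineOn τ m t) :
    ∃ C, ∀ s ∈ Icc (0 : ℝ) 1, |τ s| ≤ C := by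
  refine ⟨∑ j ∈ Finset.range (m + 1), |τ (t j)|, fun s hs => ?_⟩
  have hC : ∀ j ≤ m, |τ (t j)| ≤ ∑ j ∈ Finset.range (m + 1), |τ (t j)| := fun j hj =>
    Finset.single_le_sum (f := fun j => |τ (t j)|) (fun _ _ => abs_nonneg _)
      (by simp; omega)
  obtain ⟨i, hi, h₁, h₂⟩ := exists_step_mem_Icc (u := t) h.one_le (h.1 ▸ hs.1) (h.2.1 ▸ hs.2)
  have hlt := (h.2.2.1 i hi).le
  have c₁ := abs_le.1 (hC i hi.le)
  have c₂ := abs_le.1 (hC (i + 1) hi)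
  rcases le_total (τ (t i)) (τ (t (i + 1))) with hle | hle
  · have := h.monotoneOn hi hle ⟨le_rfl, hlt⟩ ⟨h₁, h₂⟩ h₁
    have := h.monotoneOn hi hle ⟨h₁, h₂⟩ ⟨hlt, le_rfl⟩ h₂
    exact abs_le.2 ⟨by linarith, by linarith⟩
  · have := h.antitoneOn hi hle ⟨le_rfl, hlt⟩ ⟨h₁, h₂⟩ h₁
    have := h.antitoneOn hi hle ⟨h₁, h₂⟩ ⟨hlt, le_rfl⟩ h₂
    exact abs_le.2 ⟨by linarith, by linarith⟩

/-- If a polygonal curve reaches height `c - D` at `y`, stays below `c + D` on `[x, z] ∋ y`, and is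
below `c - D` at those of `x`, `z` that are not endpoints of the curve, then it has a vertex of
height within `D` of `c`. -/
theorem IsPolylineOn.exists_vertex_near {τ : ℝ → ℝ} {m : ℕ} {t : ℕ → ℝ} (h : IsPolylineOn τ m t)
    {x y z c D : ℝ} (hx0 : 0 ≤ x) (hz1 : z ≤ 1) (hxy : x ≤ y) (hyz : y ≤ z) (hy : c - D ≤ τ y)
    (hle : ∀ s, x ≤ s → s ≤ z → τ s ≤ c + D) (hx : x = 0 ∨ τ x < c - D)
    (hz : z = 1 ∨ τ z < c - D) : ∃ j ≤ m, |τ (t j) - c| ≤ D := by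
  obtain ⟨i, hi, h₁, h₂⟩ := exists_step_mem_Icc (u := t) (x := y) h.one_le
    (by rw [h.1]; linarith) (by rw [h.2.1]; linarith)
  have hlt := (h.2.2.1 i hi).le
  have ht0 : 0 ≤ t i := h.1 ▸ h.strictMonoOn.monotoneOn (by simp) (by simp; omega) (Nat.zero_le i)
  have ht1 : t (i + 1) ≤ 1 := h.2.1 ▸ h.strictMonoOn.monotoneOn (by simp; omega) (by simp) hi
  rcases le_total (τ (t i)) (τ (t (i + 1))) with hm | hm
  · have hmon := h.monotoneOn hi hm
    refine ⟨i + 1, hi, ?_⟩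
    have hlz : t (i + 1) ≤ z := by
      by_contra! hc
      rcases hz with hz | hz
      · linarith
      · have := hmon ⟨h₁, h₂⟩ ⟨h₁.trans hyz, hc.le⟩ hyz
        linarith
    have := hle _ (hxy.trans h₂) hlz
    have := hmon ⟨h₁, h₂⟩ ⟨hlt, le_rfl⟩ h₂
    exact abs_le.2 ⟨by linarith, by linarith⟩
  · have hmon := h.antitoneOn hi hm
    refine ⟨i, hi.le, ?_⟩
    have hlx : x ≤ t i := by
      by_contra! hc
      rcases hx with hx | hx
      · linarith
      · have := hmon ⟨hc.le, hxy.trans h₂⟩ ⟨h₁, h₂⟩ hxy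
        linarith
    have := hle _ hlx (h₁.trans hyz)
    have := hmon ⟨le_rfl, hlt⟩ ⟨h₁, h₂⟩ h₁
    exact abs_le.2 ⟨by linarith, by linarith⟩

theorem exists_monotone_lift {φ : ℝ → ℝ} (hφ : ContinuousOn φ (Icc 0 1))
    (hφm : MonotoneOn φ (Icc 0 1)) (hφ0 : φ 0 = 0) (hφ1 : φ 1 = 1) {p : ℕ → ℝ} {n : ℕ} (hn : 1 ≤ n)
    (hp : StrictMonoOn p (Set.Iic n)) (hp0 : p 0 = 0) (hpn : p n = 1) :
    ∃ u : ℕ → ℝ, u 0 = 0 ∧ u n = 1 ∧ StrictMonoOn u (Set.Iic n) ∧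
      ∀ i ≤ n, u i ∈ Icc (0 : ℝ) 1 ∧ φ (u i) = p i := by
  have key : ∀ i, ∃ x, (i = 0 → x = 0) ∧ (i = n → x = 1) ∧
      (i ≤ n → x ∈ Icc (0 : ℝ) 1 ∧ φ x = p i) := by
    intro i
    by_cases h0 : i = 0
    · exact ⟨0, fun _ => rfl, fun h => by omega, fun _ => ⟨by simp, by rw [hφ0, h0, hp0]⟩⟩
    by_cases h1 : i = n
    · exact ⟨1, fun h => by omega, fun _ => rfl, fun _ => ⟨by simp, by rw [hφ1, h1, hpn]⟩⟩
    by_cases hi : i ≤ n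
    · have := intermediate_value_Icc (zero_le_one' ℝ) hφ
      rw [hφ0, hφ1] at this
      obtain ⟨x, hx, hxp⟩ := this (a := p i)
        ⟨hp0 ▸ hp.monotoneOn (by simp) hi (Nat.zero_le i), hpn ▸ hp.monotoneOn hi (by simp) hi⟩
      exact ⟨x, fun h => absurd h h0, fun h => absurd h h1, fun _ => ⟨hx, hxp⟩⟩
    · exact ⟨0, fun h => absurd h h0, fun h => absurd h h1, fun h => absurd h hi⟩
  choose u h0 h1 hu using key
  refine ⟨u, h0 0 rfl, h1 n rfl, fun i hi j hj hij => ?_, hu⟩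
  by_contra! hc
  have := hφm (hu j hj).1 (hu i hi).1 hc
  rw [(hu j hj).2, (hu i hi).2] at this
  exact this.not_gt (hp hi hj hij)

theorem IsDeltaSignature.lt_abs_sub {δ : ℝ} {τ : ℝ → ℝ} {ℓ : ℕ} {t : ℕ → ℝ}
    (h : IsDeltaSignature δ τ ℓ t) (hδ : 0 ≤ δ) {i : ℕ} (hi : i < ℓ) :
    δ < |τ (t (i + 1)) - τ (t i)| := by
  by_cases hb : i = 0 ∨ i = ℓ - 1
  · exact h.minedge_bnd i hi hb
  · have := h.minedge_int i (by omega) (by omega)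
    linarith

theorem IsDeltaSignature.strictMonoOn {δ : ℝ} {τ : ℝ → ℝ} {ℓ : ℕ} {t : ℕ → ℝ}
    (h : IsDeltaSignature δ τ ℓ t) : StrictMonoOn t (Set.Iic ℓ) :=
  strictMonoOn_Iic_of_lt_succ h.mono

/-- On the edge before an interior vertex, a curve stays on one side of that vertex. -/
theorem IsDeltaSignature.range_left {δ : ℝ} {τ : ℝ → ℝ} {ℓ : ℕ} {t : ℕ → ℝ}
    (h : IsDeltaSignature δ τ ℓ t) (hδ : 0 ≤ δ) {i : ℕ} (hi : i + 1 < ℓ) {s : ℝ}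
    (h₁ : t i ≤ s) (h₂ : s ≤ t (i + 1)) :
    (τ (t i) < τ (t (i + 1)) → τ s ≤ τ (t (i + 1))) ∧
      (τ (t (i + 1)) < τ (t i) → τ (t (i + 1)) ≤ τ s) := by
  have hlt := h.lt_abs_sub hδ (show i < ℓ by omega)
  rcases Nat.eq_zero_or_pos i with rfl | hi0
  · have := h.range_first (by omega) s h₁ h₂
    rw [zero_add] at *
    simp only [Set.mem_union, Set.mem_uIcc, Set.mem_Icc] at this
    grind
  · have := h.range_int i hi0 (by omega) s h₁ h₂
    simp only [Set.mem_uIcc] at this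
    grind

/-- On the edge after an interior vertex, a curve stays on one side of that vertex. -/
theorem IsDeltaSignature.range_right {δ : ℝ} {τ : ℝ → ℝ} {ℓ : ℕ} {t : ℕ → ℝ}
    (h : IsDeltaSignature δ τ ℓ t) (hδ : 0 ≤ δ) {i : ℕ} (hi : 1 ≤ i) (hil : i < ℓ) {s : ℝ}
    (h₁ : t i ≤ s) (h₂ : s ≤ t (i + 1)) :
    (τ (t (i + 1)) < τ (t i) → τ s ≤ τ (t i)) ∧
      (τ (t i) < τ (t (i + 1)) → τ (t i) ≤ τ s) := by
  have hlt := h.lt_abs_sub hδ hil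
  rcases Nat.lt_or_ge (i + 1) ℓ with hi0 | hi0
  · have := h.range_int i hi (by omega) s h₁ h₂
    simp only [Set.mem_uIcc] at this
    grind
  · obtain rfl : ℓ = i + 1 := by omega
    have := h.range_last (by omega) s (by simpa using h₁) h₂
    simp only [Set.mem_union, Set.mem_uIcc, Set.mem_Icc, Nat.add_sub_cancel] at this
    grind

/-- Curves within distance `D`, with a fixed matching realizing it, have the same vertex sequence
after snapping when no vertex of `τ` is within `3 * D` of a change of the snapping map `g`. -/
theorem vertexSeq_signature_eq {α : Type*} [LinearOrder α] {D : ℝ} (hD : 0 ≤ D) {π τ : ℝ → ℝ}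
    {ℓ : ℕ} {p : ℕ → ℝ} (hsig : IsDeltaSignature D π ℓ p) {m : ℕ} {t : ℕ → ℝ}
    (hτ : IsPolylineOn τ m t) {φ ψ : ℝ → ℝ} (hφ : ContinuousOn φ (Icc 0 1))
    (hψ : ContinuousOn ψ (Icc 0 1)) (hφm : MonotoneOn φ (Icc 0 1)) (hψm : MonotoneOn ψ (Icc 0 1))
    (hφ0 : φ 0 = 0) (hφ1 : φ 1 = 1) (hψ0 : ψ 0 = 0) (hψ1 : ψ 1 = 1)
    (hd : ∀ s ∈ Icc (0 : ℝ) 1, |π (φ s) - τ (ψ s)| ≤ D) {g : ℝ → α} (hg : Monotone g)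
    (hgt : ∀ j ≤ m, ∀ x, |x - τ (t j)| ≤ 3 * D → g x = g (τ (t j))) :
    vertexSeq ((List.range (ℓ + 1)).map fun i => g (π (p i))) =
      vertexSeq ((List.range (m + 1)).map fun j => g (τ (t j))) := by
  obtain ⟨u, hu0, hu1, hu, huφ⟩ := exists_monotone_lift hφ hφm hφ0 hφ1 hsig.one_le
    hsig.strictMonoOn hsig.start hsig.finish
  obtain ⟨v, hv0, hv1, hv, hvψ⟩ := exists_monotone_lift hψ hψm hψ0 hψ1 hτ.one_le
    hτ.strictMonoOn hτ.1 hτ.2.1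
  have hdu : ∀ i ≤ ℓ, |π (p i) - τ (ψ (u i))| ≤ D := fun i hi => by
    simpa [(huφ i hi).2] using hd _ (huφ i hi).1
  have hnear : ∀ i ≤ ℓ, ∃ j ≤ m, |τ (t j) - π (p i)| ≤ D := by
    intro i hi
    rcases Nat.eq_zero_or_pos i with rfl | hi0
    · refine ⟨0, Nat.zero_le _, ?_⟩
      have := hd 0 (by simp)
      rw [abs_sub_comm]
      simpa [hφ0, hψ0, hsig.start, hτ.1] using this
    rcases hi.eq_or_lt with rfl | hil
    · refine ⟨m, le_rfl, ?_⟩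
      have := hd 1 (by simp)
      rw [abs_sub_comm]
      simpa [hφ1, hψ1, hsig.finish, hτ.2.1] using this
    obtain ⟨k, rfl⟩ : ∃ k, i = k + 1 := ⟨i - 1, by omega⟩
    have hk : k ≤ ℓ := by omega
    have uk := huφ k hk
    have uk1 := huφ (k + 1) hi
    have uk2 := huφ (k + 2) hil
    have u01 : u k ≤ u (k + 1) := (hu hk hi (by omega)).le
    have u12 : u (k + 1) ≤ u (k + 2) := (hu hi hil (by omega)).le
    have q01 := hψm uk.1 uk1.1 u01
    have q12 := hψm uk1.1 uk2.1 u12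
    have q0 : 0 ≤ ψ (u k) := hψ0 ▸ hψm (by simp) uk.1 uk.1.1
    have q1 : ψ (u (k + 2)) ≤ 1 := hψ1 ▸ hψm uk2.1 (by simp) uk2.1.2
    have hd0 := abs_le.1 (hdu k hk)
    have hd1 := abs_le.1 (hdu (k + 1) hi)
    have hd2 := abs_le.1 (hdu (k + 2) hil)
    have hpt : ∀ y, ψ (u k) ≤ y → y ≤ ψ (u (k + 2)) → ∃ s, |π s - τ y| ≤ D ∧
        p k ≤ s ∧ s ≤ p (k + 2) := by
      intro y hy₁ hy₂
      have hsub : Icc (u k) (u (k + 2)) ⊆ Icc 0 1 := Icc_subset_Icc uk.1.1 uk2.1.2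
      obtain ⟨s, hs, rfl⟩ := intermediate_value_Icc (u01.trans u12) (hψ.mono hsub) ⟨hy₁, hy₂⟩
      exact ⟨φ s, hd s (hsub hs), uk.2 ▸ hφm uk.1 (hsub hs) hs.1,
        uk2.2 ▸ hφm (hsub hs) uk2.1 hs.2⟩
    have hside : ∀ s, p k ≤ s → s ≤ p (k + 2) →
        (π (p k) < π (p (k + 1)) → π (p (k + 2)) < π (p (k + 1)) → π s ≤ π (p (k + 1))) ∧
        (π (p (k + 1)) < π (p k) → π (p (k + 1)) < π (p (k + 2)) → π (p (k + 1)) ≤ π s) := by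
      intro s hs₁ hs₂
      rcases le_total s (p (k + 1)) with h | h
      · have := hsig.range_left hD hil hs₁ h
        exact ⟨fun h _ => this.1 h, fun h _ => this.2 h⟩
      · have := hsig.range_right hD hi0 hil h hs₂
        exact ⟨fun _ h => this.1 h, fun _ h => this.2 h⟩
    have hfirst : ψ (u k) = 0 ∨ 2 * D < |π (p (k + 1)) - π (p k)| := by
      rcases Nat.eq_zero_or_pos k with rfl | hk0
      · left; rw [hu0, hψ0]
      · exact .inr (hsig.minedge_int k hk0 (by omega))
    have hlast : ψ (u (k + 2)) = 1 ∨ 2 * D < |π (p (k + 2)) - π (p (k + 1))| := by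
      rcases Nat.lt_or_ge (k + 2) ℓ with hk0 | hk0
      · exact .inr (hsig.minedge_int (k + 1) hi0 (by omega))
      · left
        obtain rfl : ℓ = k + 2 := by omega
        rw [hu1, hψ1]
    have hnd := hsig.nondeg (k + 1) hi0 hil
    simp only [Nat.add_sub_cancel, Set.mem_uIcc, not_or, not_and_or, not_le] at hnd
    have hcase : (π (p k) < π (p (k + 1)) ∧ π (p (k + 2)) < π (p (k + 1))) ∨
        (π (p (k + 1)) < π (p k) ∧ π (p (k + 1)) < π (p (k + 2))) := by
      rcases hnd with ⟨h₁ | h₁, h₂ | h₂⟩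
      · exact .inr ⟨h₁, h₂⟩
      · exact absurd h₁ h₂.not_gt
      · exact absurd h₁ h₂.not_gt
      · exact .inl ⟨h₂, h₁⟩
    rcases hcase with ⟨c₁, c₂⟩ | ⟨c₁, c₂⟩
    · refine hτ.exists_vertex_near q0 q1 q01 q12 (by linarith) ?_ ?_ ?_
      · intro y hy₁ hy₂
        obtain ⟨s, hs, hs₁, hs₂⟩ := hpt y hy₁ hy₂
        have := (hside s hs₁ hs₂).1 c₁ c₂
        have := (abs_le.1 hs).1
        linarith
      · refine hfirst.imp_right fun h => ?_
        rw [abs_of_pos (by linarith)] at h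
        linarith
      · refine hlast.imp_right fun h => ?_
        rw [abs_of_neg (by linarith)] at h
        linarith
    · suffices h : ∃ j ≤ m, |-τ (t j) - -π (p (k + 1))| ≤ D by
        simpa only [neg_sub_neg, abs_sub_comm] using h
      refine hτ.neg.exists_vertex_near q0 q1 q01 q12 (by linarith) ?_ ?_ ?_
      · intro y hy₁ hy₂
        obtain ⟨s, hs, hs₁, hs₂⟩ := hpt y hy₁ hy₂
        have := (hside s hs₁ hs₂).2 c₁ c₂
        have := (abs_le.1 hs).2
        linarith
      · refine hfirst.imp_right fun h => ?_
        rw [abs_of_neg (by linarith)] at h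
        linarith
      · refine hlast.imp_right fun h => ?_
        rw [abs_of_pos (by linarith)] at h
        linarith
  set f : ℝ → ℝ := fun s => τ (ψ s) with hf
  have hfv : ∀ j ≤ m, f (v j) = τ (t j) := fun j hj => by rw [hf]; simp only [(hvψ j hj).2]
  have hgu : ∀ i ≤ ℓ, g (f (u i)) = g (π (p i)) ∧
      ∀ x, |x - f (u i)| ≤ D → g x = g (f (u i)) := by
    intro i hi
    obtain ⟨j, hj, hjD⟩ := hnear i hi
    have h₁ := abs_le.1 (hdu i hi)
    have h₂ := abs_le.1 hjD
    have e₁ : g (f (u i)) = g (τ (t j)) :=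
      hgt j hj _ (abs_le.2 ⟨by simp only [hf]; linarith, by simp only [hf]; linarith⟩)
    have e₂ : g (π (p i)) = g (τ (t j)) := hgt j hj _ (abs_le.2 ⟨by linarith, by linarith⟩)
    refine ⟨e₁.trans e₂.symm, fun x hx => ?_⟩
    have h₃ := abs_le.1 hx
    rw [e₁]
    simp only [hf] at h₃
    exact hgt j hj _ (abs_le.2 ⟨by linarith, by linarith⟩)
  have hgv : ∀ j ≤ m, ∀ x, |x - f (v j)| ≤ 3 * D → g x = g (f (v j)) := by
    intro j hj
    rw [hfv j hj]
    exact hgt j hj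
  set T : Finset ℝ := (Finset.range (ℓ + 1)).image u ∪ (Finset.range (m + 1)).image v with hT
  have memT : ∀ x ∈ T, (∃ i ≤ ℓ, u i = x) ∨ ∃ j ≤ m, v j = x := by
    intro x hx
    simpa [hT, Nat.lt_succ_iff] using hx
  have uT : ∀ i ≤ ℓ, u i ∈ T := fun i hi =>
    Finset.mem_union_left _ (Finset.mem_image_of_mem _ (by simp; omega))
  have vT : ∀ j ≤ m, v j ∈ T := fun j hj =>
    Finset.mem_union_right _ (Finset.mem_image_of_mem _ (by simp; omega))
  have T01 : ∀ x ∈ T, x ∈ Icc (0 : ℝ) 1 := by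
    intro x hx
    rcases memT x hx with ⟨i, hi, rfl⟩ | ⟨j, hj, rfl⟩
    exacts [(huφ i hi).1, (hvψ j hj).1]
  have hT1 : ∀ x ∈ T, (∃ i ≤ ℓ, u i = x) ∨ ∀ y, |y - f x| ≤ 3 * D → g y = g (f x) := by
    intro x hx
    rcases memT x hx with h | ⟨j, hj, rfl⟩
    exacts [.inl h, .inr (hgv j hj)]
  have hTD : ∀ x ∈ T, ∀ y, |y - f x| ≤ D → g y = g (f x) := by
    intro x hx y hy
    rcases hT1 x hx with ⟨i, hi, rfl⟩ | h
    exacts [(hgu i hi).2 y hy, h y (by linarith)]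
  have hclose : ∀ x ∈ T, ∀ y ∈ T, f x - f y ≤ 4 * D →
      ((∃ i ≤ ℓ, u i = x) ∧ (∃ i ≤ ℓ, u i = y)) ∨ g (f x) ≤ g (f y) := by
    intro x hx y hy hxy
    rcases le_total (f x) (f y) with hle | hle
    · exact .inr (hg hle)
    rcases hT1 x hx with h | h
    · rcases hT1 y hy with h' | h'
      · exact .inl ⟨h, h'⟩
      · right
        rw [← hTD x hx ((3 * f x + f y) / 4) (abs_le.2 ⟨by linarith, by linarith⟩),
          h' ((3 * f x + f y) / 4) (abs_le.2 ⟨by linarith, by linarith⟩)]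
    · right
      rw [← hTD y hy ((3 * f y + f x) / 4) (abs_le.2 ⟨by linarith, by linarith⟩),
        h ((3 * f y + f x) / 4) (abs_le.2 ⟨by linarith, by linarith⟩)]
  have hends : ∀ i < ℓ, ∀ k ≤ ℓ, u i ≤ u k → u k ≤ u (i + 1) → k = i ∨ k = i + 1 := by
    intro i hi k hk h₁ h₂
    have := (hu.le_iff_le (Set.mem_Iic.2 hi.le) (Set.mem_Iic.2 hk)).1 h₁
    have := (hu.le_iff_le (Set.mem_Iic.2 hk) (Set.mem_Iic.2 hi)).1 h₂
    omega
  have hφu : ∀ i < ℓ, ∀ x ∈ Icc (u i) (u (i + 1)), x ∈ Icc (0 : ℝ) 1 →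
      p i ≤ φ x ∧ φ x ≤ p (i + 1) := fun i hi x hx hx01 =>
    ⟨(huφ i hi.le).2 ▸ hφm (huφ i hi.le).1 hx01 hx.1,
      (huφ (i + 1) hi).2 ▸ hφm hx01 (huφ (i + 1) hi).1 hx.2⟩
  have eu : ((List.range (ℓ + 1)).map fun i => g (π (p i))) =
      (List.range (ℓ + 1)).map fun i => (g ∘ f) (u i) :=
    List.map_congr_left fun i hi => ((hgu i (by simp at hi; omega)).1).symm
  have ev : ((List.range (m + 1)).map fun j => g (τ (t j))) =
      (List.range (m + 1)).map fun j => (g ∘ f) (v j) :=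
    List.map_congr_left fun j hj => by
      simp only [Function.comp_apply]
      rw [hfv j (by simp at hj; omega)]
  rw [eu, ev, ← vertexSeq_map_sort_eq_map_range (g ∘ f) hsig.one_le hu T uT,
    ← vertexSeq_map_sort_eq_map_range (g ∘ f) hτ.one_le hv T vT]
  · intro x hx
    rw [hv0, hv1]
    exact T01 x hx
  · intro j hj
    have hsub : ∀ x ∈ (↑T ∩ Icc (v j) (v (j + 1)) : Set ℝ), x ∈ Icc (0 : ℝ) 1 ∧
        ψ x ∈ Icc (t j) (t (j + 1)) := by
      rintro x ⟨hx, hxI⟩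
      have hx01 := T01 x hx
      exact ⟨hx01, (hvψ j hj.le).2 ▸ hψm (hvψ j hj.le).1 hx01 hxI.1,
        (hvψ (j + 1) hj).2 ▸ hψm hx01 (hvψ (j + 1) hj).1 hxI.2⟩
    rcases le_total (τ (t j)) (τ (t (j + 1))) with hle | hle
    · left
      intro x hx y hy hxy
      exact hg (hτ.monotoneOn hj hle (hsub x hx).2 (hsub y hy).2
        (hψm (hsub x hx).1 (hsub y hy).1 hxy))
    · right
      intro x hx y hy hxy
      exact hg (hτ.antitoneOn hj hle (hsub x hx).2 (hsub y hy).2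
        (hψm (hsub x hx).1 (hsub y hy).1 hxy))
  · intro x hx
    rw [hu0, hu1]
    exact T01 x hx
  · intro i hi
    have hne : π (p i) ≠ π (p (i + 1)) := by
      intro h
      have := hsig.lt_abs_sub hD hi
      rw [h, sub_self, abs_zero] at this
      linarith
    have hii := hu (Set.mem_Iic.2 hi.le) (Set.mem_Iic.2 hi) (Nat.lt_succ_self i)
    rcases hne.lt_or_gt with hlt | hlt
    · left
      rintro x ⟨hx, hxI⟩ y ⟨hy, hyI⟩ hxy
      have hx' := hφu i hi x hxI (T01 x hx)
      have hy' := hφu i hi y hyI (T01 y hy)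
      have hdir := hsig.dir_up i hi hlt (φ x) (φ y) hx'.1 (hφm (T01 x hx) (T01 y hy) hxy) hy'.2
      have h₁ := abs_le.1 (hd x (T01 x hx))
      have h₂ := abs_le.1 (hd y (T01 y hy))
      rcases hclose x hx y hy (by simp only [hf]; linarith) with
        ⟨⟨a, ha, rfl⟩, ⟨b, hb, rfl⟩⟩ | h
      · rcases hends i hi a ha hxI.1 hxI.2 with rfl | rfl <;>
        rcases hends _ hi b hb hyI.1 hyI.2 with rfl | rfl
        · exact le_rfl
        · simp only [Function.comp_apply]
          rw [(hgu _ ha).1, (hgu _ hb).1]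
          exact hg hlt.le
        · exact absurd hxy hii.not_ge
        · exact le_rfl
      · exact h
    · right
      rintro x ⟨hx, hxI⟩ y ⟨hy, hyI⟩ hxy
      have hx' := hφu i hi x hxI (T01 x hx)
      have hy' := hφu i hi y hyI (T01 y hy)
      have hdir := hsig.dir_down i hi hlt (φ x) (φ y) hx'.1 (hφm (T01 x hx) (T01 y hy) hxy) hy'.2
      have h₁ := abs_le.1 (hd x (T01 x hx))
      have h₂ := abs_le.1 (hd y (T01 y hy))
      rcases hclose y hy x hx (by simp only [hf]; linarith) with
        ⟨⟨b, hb, rfl⟩, ⟨a, ha, rfl⟩⟩ | h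
      · rcases hends i hi a ha hxI.1 hxI.2 with rfl | rfl <;>
        rcases hends _ hi b hb hyI.1 hyI.2 with rfl | rfl
        · exact le_rfl
        · simp only [Function.comp_apply]
          rw [(hgu _ ha).1, (hgu _ hb).1]
          exact hg hlt.le
        · exact absurd hxy hii.not_ge
        · exact le_rfl
      · exact h

theorem IsDeltaSignature.eventually_add {δ : ℝ} {τ : ℝ → ℝ} {ℓ : ℕ} {t : ℕ → ℝ}
    (h : IsDeltaSignature δ τ ℓ t) :
    ∀ᶠ D in nhdsWithin δ (Set.Ioi δ), IsDeltaSignature D τ ℓ t := by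
  have h₁ : ∀ᶠ D in nhdsWithin δ (Set.Ioi δ), ∀ i ∈ Finset.range ℓ, 1 ≤ i ∧ i ≤ ℓ - 2 →
      2 * D < |τ (t (i + 1)) - τ (t i)| := by
    rw [Filter.eventually_all_finset]
    intro i _
    rw [Filter.eventually_imp_distrib_left]
    intro hi
    refine Filter.Eventually.filter_mono nhdsWithin_le_nhds ?_
    exact (continuous_const.mul continuous_id).continuousAt.eventually_lt_const
      (h.minedge_int i hi.1 hi.2)
  have h₂ : ∀ᶠ D in nhdsWithin δ (Set.Ioi δ), ∀ i ∈ Finset.range ℓ, (i = 0 ∨ i = ℓ - 1) →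
      D < |τ (t (i + 1)) - τ (t i)| := by
    rw [Filter.eventually_all_finset]
    intro i hi
    rw [Filter.eventually_imp_distrib_left]
    intro hi'
    refine Filter.Eventually.filter_mono nhdsWithin_le_nhds ?_
    exact eventually_lt_nhds (h.minedge_bnd i (Finset.mem_range.1 hi) hi')
  filter_upwards [h₁, h₂, self_mem_nhdsWithin] with D hD₁ hD₂ hD
  have hD : δ ≤ D := le_of_lt hD
  have hIcc : ∀ x, Icc (x - δ) (x + δ) ⊆ Icc (x - D) (x + D) := fun x =>
    Icc_subset_Icc (by linarith) (by linarith)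
  exact
    { one_le := h.one_le
      mono := h.mono
      start := h.start
      finish := h.finish
      nondeg := h.nondeg
      dir_up := fun i hi hlt a b h₁ h₂ h₃ => (h.dir_up i hi hlt a b h₁ h₂ h₃).trans (by linarith)
      dir_down := fun i hi hlt a b h₁ h₂ h₃ =>
        (h.dir_down i hi hlt a b h₁ h₂ h₃).trans (by linarith)
      minedge_int := fun i h₁ h₂ => hD₁ i (Finset.mem_range.2 (by omega)) ⟨h₁, h₂⟩
      minedge_bnd := fun i hi h' => hD₂ i (Finset.mem_range.2 hi) h'
      range_int := h.range_int
      range_first := fun h₁ s h₂ h₃ =>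
        union_subset_union_right _ (hIcc _) (h.range_first h₁ s h₂ h₃)
      range_last := fun h₁ s h₂ h₃ =>
        union_subset_union_right _ (hIcc _) (h.range_last h₁ s h₂ h₃)
      range_single := fun h₁ s h₂ h₃ =>
        union_subset_union (union_subset_union_right _ (hIcc _)) (hIcc _)
          (h.range_single h₁ s h₂ h₃) }

open MeasureTheory Pointwise in
/-- The shifts `z ∈ (0, w]` for which a grid line separates the ends of `[a, b]` have measure at
most `b - a`. -/
theorem volume_floor_ne_le {w : ℝ} (hw : 0 < w) (a b : ℝ) :
    volume ({z | ⌊(a - z) / w⌋ ≠ ⌊(b - z) / w⌋ ∧ a ≤ b} ∩ Ioc 0 w) ≤ ENNReal.ofReal (b - a) := by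
  have hsub : {z | ⌊(a - z) / w⌋ ≠ ⌊(b - z) / w⌋ ∧ a ≤ b} ∩ Ioc 0 w ⊆
      ⋃ c : AddSubgroup.zmultiples w, (c +ᵥ Ioc a b) ∩ Ioc 0 w := by
    rintro z ⟨⟨hz, hab⟩, hzw⟩
    have hlt : ⌊(a - z) / w⌋ < ⌊(b - z) / w⌋ :=
      lt_of_le_of_ne (Int.floor_mono (by gcongr)) hz
    rw [Int.floor_lt, div_lt_iff₀ hw] at hlt
    have hle := Int.floor_le ((b - z) / w)
    rw [le_div_iff₀ hw] at hle
    refine mem_iUnion.2 ⟨⟨(-⌊(b - z) / w⌋) • w, ⟨_, rfl⟩⟩, ?_, hzw⟩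
    rw [Set.mem_vadd_set_iff_neg_vadd_mem, AddSubgroup.vadd_def]
    simp only [AddSubgroup.coe_neg, neg_smul, neg_neg, zsmul_eq_mul, vadd_eq_add, Set.mem_Ioc]
    exact ⟨by linarith, by linarith⟩
  calc _ ≤ ∑' c : AddSubgroup.zmultiples w, volume ((c +ᵥ Ioc a b) ∩ Ioc 0 w) :=
        (measure_mono hsub).trans (measure_iUnion_le _)
    _ = volume (Ioc a b) := by
        have := (isAddFundamentalDomain_Ioc hw 0).measure_eq_tsum (Ioc a b)
        rw [zero_add] at this
        exact this.symm
    _ = ENNReal.ofReal (b - a) := Real.volume_Ioc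

theorem exists_matching_of_frechetDist_lt {π τ : ℝ → ℝ} (hπ : ContinuousOn π (Icc 0 1)) {m : ℕ}
    {t : ℕ → ℝ} (hτ : IsPolylineOn τ m t) {D : ℝ} (hD : frechetDist π τ < D) :
    ∃ φ ψ : ℝ → ℝ, ContinuousOn φ (Icc 0 1) ∧ ContinuousOn ψ (Icc 0 1) ∧
      MonotoneOn φ (Icc 0 1) ∧ MonotoneOn ψ (Icc 0 1) ∧ φ 0 = 0 ∧ φ 1 = 1 ∧ ψ 0 = 0 ∧ ψ 1 = 1 ∧
      ∀ s ∈ Icc (0 : ℝ) 1, |π (φ s) - τ (ψ s)| ≤ D := by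
  obtain ⟨C, hC⟩ := isCompact_Icc.exists_bound_of_continuousOn hπ
  obtain ⟨C', hC'⟩ := hτ.exists_abs_le
  obtain ⟨r, ⟨φ, ψ, h₁, h₂, h₃, h₄, h₅, h₆, h₇, h₈, h₉⟩, hr⟩ := by
    refine exists_lt_of_csInf_lt ?_ hD
    exact ⟨C + C', id, id, continuousOn_id, continuousOn_id, monotoneOn_id, monotoneOn_id, rfl, rfl,
      rfl, rfl, fun s hs => (abs_sub _ _).trans (add_le_add (hC s hs) (hC' s hs))⟩
  exact ⟨φ, ψ, h₁, h₂, h₃, h₄, h₅, h₆, h₇, h₈, fun s hs => (h₉ s hs).trans hr.le⟩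

open MeasureTheory ProbabilityTheory in
/-- for `d_F(π,τ) ≤ δ`, the probability (over a uniformly random shift
`z ∈ [0,w]`) that snapping the signature vertices of `π` and the vertices of `τ`
(a time series with `k = m + 1` vertices) to the shifted grid yields different
vertex sequences is at most `6kδ/w`. -/
theorem grid_snapping_same_key (δ w : ℝ) (hδ : 0 ≤ δ) (hw : 0 < w)
    (π τ : ℝ → ℝ) (hπ : ContinuousOn π (Set.Icc 0 1))
    (ℓ : ℕ) (p : ℕ → ℝ) (hsig : IsDeltaSignature δ π ℓ p)
    (m : ℕ) (t : ℕ → ℝ) (hτ : IsPolylineOn τ m t)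
    (hd : frechetDist π τ ≤ δ) :
    (volume[|Set.Icc (0:ℝ) w])
        {z | vertexSeq ((List.range (ℓ + 1)).map (fun i => ⌊(π (p i) - z) / w⌋))
              ≠ vertexSeq ((List.range (m + 1)).map (fun i => ⌊(τ (t i) - z) / w⌋))}
      ≤ ENNReal.ofReal (6 * (m + 1) * δ / w) := by
  have hbound : ∀ᶠ D in nhdsWithin δ (Set.Ioi δ),
      (volume[|Set.Icc (0:ℝ) w])
        {z | vertexSeq ((List.range (ℓ + 1)).map (fun i => ⌊(π (p i) - z) / w⌋))
              ≠ vertexSeq ((List.range (m + 1)).map (fun i => ⌊(τ (t i) - z) / w⌋))}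
      ≤ ENNReal.ofReal (6 * (m + 1) * D / w) := by
    filter_upwards [hsig.eventually_add, self_mem_nhdsWithin] with D hsigD hδD
    have hδD : δ < D := hδD
    have hD : 0 ≤ D := hδ.trans hδD.le
    obtain ⟨φ, ψ, h₁, h₂, h₃, h₄, h₅, h₆, h₇, h₈, h₉⟩ :=
      exists_matching_of_frechetDist_lt hπ hτ (hd.trans_lt hδD)
    rw [cond_apply measurableSet_Icc, Real.volume_Icc, sub_zero]
    have hsub : Set.Icc 0 w ∩
        {z | vertexSeq ((List.range (ℓ + 1)).map (fun i => ⌊(π (p i) - z) / w⌋))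
              ≠ vertexSeq ((List.range (m + 1)).map (fun i => ⌊(τ (t i) - z) / w⌋))} ⊆
        {0} ∪ ⋃ j ∈ Finset.range (m + 1), ({z | ⌊(τ (t j) - 3 * D - z) / w⌋ ≠
          ⌊(τ (t j) + 3 * D - z) / w⌋ ∧ τ (t j) - 3 * D ≤ τ (t j) + 3 * D} ∩ Set.Ioc 0 w) := by
      rintro z ⟨hzw, hz⟩
      rcases hzw.1.eq_or_lt with h0 | h0
      · exact .inl h0.symm
      right
      by_contra hc
      simp only [Set.mem_iUnion, not_exists] at hc
      have hmono : Monotone fun x : ℝ => ⌊(x - z) / w⌋ := fun x y hxy =>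
        Int.floor_mono (by gcongr)
      refine hz (vertexSeq_signature_eq hD hsigD hτ h₁ h₂ h₃ h₄ h₅ h₆ h₇ h₈ h₉ hmono ?_)
      intro j hj x hx
      have hx := abs_le.1 hx
      have heq : ⌊(τ (t j) - 3 * D - z) / w⌋ = ⌊(τ (t j) + 3 * D - z) / w⌋ := by
        by_contra hne
        exact hc j (Finset.mem_range.2 (by omega)) ⟨⟨hne, by linarith⟩, h0, hzw.2⟩
      have i₁ := hmono (show τ (t j) - 3 * D ≤ x by linarith)
      have i₂ := hmono (show x ≤ τ (t j) + 3 * D by linarith)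
      have i₃ := hmono (show τ (t j) - 3 * D ≤ τ (t j) by linarith)
      have i₄ := hmono (show τ (t j) ≤ τ (t j) + 3 * D by linarith)
      simp only at i₁ i₂ i₃ i₄ ⊢
      omega
    have hvol := calc
      volume (Set.Icc 0 w ∩
        {z | vertexSeq ((List.range (ℓ + 1)).map (fun i => ⌊(π (p i) - z) / w⌋))
              ≠ vertexSeq ((List.range (m + 1)).map (fun i => ⌊(τ (t i) - z) / w⌋))})
        ≤ 0 + ∑ j ∈ Finset.range (m + 1), ENNReal.ofReal (6 * D) := by
          refine (measure_mono hsub).trans ((measure_union_le _ _).trans ?_)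
          refine add_le_add (by simp) ((measure_biUnion_finset_le _ _).trans ?_)
          refine Finset.sum_le_sum fun j _ => (volume_floor_ne_le hw _ _).trans_eq ?_
          congr 1
          ring
      _ = ENNReal.ofReal (6 * (m + 1) * D) := by
          rw [zero_add, Finset.sum_const, Finset.card_range, nsmul_eq_mul,
            ← ENNReal.ofReal_natCast, ← ENNReal.ofReal_mul (by positivity)]
          congr 1
          push_cast
          ring
    calc _ ≤ (ENNReal.ofReal w)⁻¹ * ENNReal.ofReal (6 * (m + 1) * D) := by gcongr
      _ = ENNReal.ofReal (6 * (m + 1) * D / w) := by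
          rw [ENNReal.ofReal_div_of_pos hw, mul_comm, div_eq_mul_inv]
  refine ge_of_tendsto (ENNReal.continuous_ofReal.continuousAt.tendsto.comp ?_) hbound
  refine Filter.Tendsto.mono_left ?_ nhdsWithin_le_nhds
  exact ContinuousAt.tendsto (f := fun D : ℝ => 6 * (m + 1) * D / w) (by fun_prop)
end

section
/- Let $\pi$ be a curve in $\mathbb{R}$ with $\delta$-signature $\sigma_\pi$ having vertices $\pi(p_1), \ldots, \pi(p_\ell)$, and let $\tau$ be a curve in $\mathbb{R}$ with vertices $\tau(t_1), \ldots, \tau(t_k)$. For any shift $z$ and width $w > 0$, let $g_{w,z}(x) = \lfloor (x-z)/w \rfloor \cdot w$ (snapping to a shifted grid of cell width $w$), and define $\sigma_\pi' = \langle g_{w,z}(\pi(p_1)), \ldots, g_{w,z}(\pi(p_\ell)) \rangle$ and $\tau' = \langle g_{w,z}(\tau(t_1)), \ldots, g_{w,z}(\tau(t_k)) \rangle$. If the vertex sequences of $\sigma_\pi'$ and $\tau'$ are equal, then $d_F(\pi, \tau) \le 2w + \delta$. -/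
open Set

/-- `f` on `[a, b]` and `g` on `[c, d]` admit monotone reparametrizations over `[0, 1]` that stay
within distance `r` of each other. -/
def FrechetMatched (r : ℝ) (f : ℝ → ℝ) (a b : ℝ) (g : ℝ → ℝ) (c d : ℝ) : Prop :=
  ∃ φ ψ : ℝ → ℝ, Continuous φ ∧ Continuous ψ ∧ Monotone φ ∧ Monotone ψ ∧
    φ 0 = a ∧ φ 1 = b ∧ ψ 0 = c ∧ ψ 1 = d ∧
    ∀ s ∈ Set.Icc (0:ℝ) 1, |f (φ s) - g (ψ s)| ≤ r

/-- Clamping to `[0, 1]`. -/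
noncomputable def clampUnit (x : ℝ) : ℝ := max 0 (min 1 x)

lemma continuous_clampUnit : Continuous clampUnit := by unfold clampUnit; fun_prop

lemma monotone_clampUnit : Monotone clampUnit := fun _ _ h =>
  max_le_max le_rfl (min_le_min le_rfl h)

lemma clampUnit_mem (x : ℝ) : clampUnit x ∈ Set.Icc (0:ℝ) 1 :=
  ⟨le_max_left _ _, max_le zero_le_one (min_le_left _ _)⟩

lemma clampUnit_of_mem {x : ℝ} (h : x ∈ Set.Icc (0:ℝ) 1) : clampUnit x = x := by
  rw [clampUnit, min_eq_right h.2, max_eq_right h.1]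

/-- The function agreeing with `α` on `[0, 1]` and growing with slope one outside. -/
noncomputable def unitExtend (α : ℝ → ℝ) (x : ℝ) : ℝ :=
  α (clampUnit x) + min x 0 + max (x - 1) 0

section unitExtend

variable {α : ℝ → ℝ}

lemma continuous_unitExtend (h : Continuous α) : Continuous (unitExtend α) := by
  have := continuous_clampUnit
  unfold unitExtend
  fun_prop

lemma monotone_unitExtend (h : Monotone α) : Monotone (unitExtend α) := fun _ _ hxy =>
  add_le_add (add_le_add (h (monotone_clampUnit hxy)) (min_le_min hxy le_rfl))
    (max_le_max (by linarith) le_rfl)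

lemma unitExtend_of_mem {x : ℝ} (h : x ∈ Set.Icc (0:ℝ) 1) : unitExtend α x = α x := by
  rw [unitExtend, clampUnit_of_mem h, min_eq_right h.1, max_eq_right (by linarith [h.2])]
  ring

lemma unitExtend_lt {x : ℝ} (h : x < 0) : unitExtend α x < α 0 := by
  have : clampUnit x = 0 := by
    rw [clampUnit, min_eq_right (by linarith), max_eq_left h.le]
  rw [unitExtend, this, min_eq_left h.le, max_eq_right (by linarith)]
  linarith

lemma lt_unitExtend {x : ℝ} (h : 1 < x) : α 1 < unitExtend α x := by
  have : clampUnit x = 1 := by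
    rw [clampUnit, min_eq_left h.le, max_eq_right zero_le_one]
  rw [unitExtend, this, min_eq_right (by linarith), max_eq_left (by linarith)]
  linarith

end unitExtend

/-- Two continuous monotone functions with the same end values on `[0, 1]` coincide after
monotone reparametrizations. -/
lemma exists_reparam_eq {α β : ℝ → ℝ} (hα : Continuous α) (hβ : Continuous β)
    (mα : Monotone α) (mβ : Monotone β) (h0 : α 0 = β 0) (h1 : α 1 = β 1) :
    ∃ x y : ℝ → ℝ, Continuous x ∧ Continuous y ∧ Monotone x ∧ Monotone y ∧
      x 0 = 0 ∧ x 1 = 1 ∧ y 0 = 0 ∧ y 1 = 1 ∧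
      ∀ s ∈ Set.Icc (0:ℝ) 1, x s ∈ Set.Icc (0:ℝ) 1 ∧ y s ∈ Set.Icc (0:ℝ) 1 ∧
        α (x s) = β (y s) := by
  set A := unitExtend α with hA
  set B := unitExtend β with hB
  have cA : Continuous A := continuous_unitExtend hα
  have cB : Continuous B := continuous_unitExtend hβ
  have mA : Monotone A := monotone_unitExtend mα
  have mB : Monotone B := monotone_unitExtend mβ
  have A0 : A 0 = α 0 := unitExtend_of_mem (by simp)
  have A1 : A 1 = α 1 := unitExtend_of_mem (by simp)
  have B0 : B 0 = β 0 := unitExtend_of_mem (by simp)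
  have B1 : B 1 = β 1 := unitExtend_of_mem (by simp)
  have h01 : α 0 ≤ α 1 := mα zero_le_one
  let S : ℝ → Set ℝ := fun s => {x | B (2 * s - x) ≤ A x}
  have closed (s : ℝ) : IsClosed (S s) := isClosed_le (by fun_prop) cA
  have nonempty (s : ℝ) : (S s).Nonempty := by
    refine ⟨max 1 (2 * s), ?_⟩
    have e1 := mA (le_max_left 1 (2 * s))
    have e2 : B (2 * s - max 1 (2 * s)) ≤ B 0 := mB (by linarith [le_max_right 1 (2 * s)])
    change B (2 * s - max 1 (2 * s)) ≤ A (max 1 (2 * s))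
    linarith
  have bdd (s : ℝ) : BddBelow (S s) := by
    refine ⟨min 0 (2 * s - 1), fun x hx => ?_⟩
    by_contra! hlt
    have e1 : A x < α 0 := unitExtend_lt (lt_of_lt_of_le hlt (min_le_left _ _))
    have e2 : B 1 ≤ B (2 * s - x) := mB (by linarith [min_le_right 0 (2 * s - 1)])
    have e3 : B (2 * s - x) ≤ A x := hx
    linarith
  let X : ℝ → ℝ := fun s => sInf (S s)
  have X_mem (s : ℝ) : B (2 * s - X s) ≤ A (X s) :=
    (closed s).csInf_mem (nonempty s) (bdd s)
  have X_eq (s : ℝ) : A (X s) = B (2 * s - X s) := by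
    refine le_antisymm ?_ (X_mem s)
    have hc : IsClosed {x | A x ≤ B (2 * s - x)} := isClosed_le cA (by fun_prop)
    have hsub : Set.Iio (X s) ⊆ {x | A x ≤ B (2 * s - x)} := fun x hx =>
      show A x ≤ B (2 * s - x) from (not_le.1 fun h => notMem_of_lt_csInf hx (bdd s) h).le
    have := closure_minimal hsub hc
    rw [closure_Iio] at this
    exact this (Set.mem_Iic.2 le_rfl)
  have X_mono : Monotone X := fun s s' hs =>
    csInf_le_csInf (bdd s) (nonempty s') fun x hx =>
      le_trans (mB (by linarith)) (show B (2 * s' - x) ≤ A x from hx)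
  have X_lip {s s' : ℝ} (hs : s ≤ s') : X s' ≤ X s + 2 * (s' - s) := by
    refine csInf_le (bdd s') ?_
    change B (2 * s' - (X s + 2 * (s' - s))) ≤ A (X s + 2 * (s' - s))
    rw [show 2 * s' - (X s + 2 * (s' - s)) = 2 * s - X s by ring]
    exact (X_mem s).trans (mA (by linarith))
  have X_cont : Continuous X := by
    refine (LipschitzWith.of_le_add_mul 2 fun s s' => ?_).continuous
    rw [Real.dist_eq]
    push_cast
    rcases le_total s s' with h | h
    · linarith [X_mono h, abs_nonneg (s - s')]
    · linarith [X_lip h, le_abs_self (s - s')]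
  have key (s : ℝ) (hs : s ∈ Set.Icc (0:ℝ) 1) :
      X s ∈ Set.Icc (0:ℝ) 1 ∧ 2 * s - X s ∈ Set.Icc (0:ℝ) 1 := by
    obtain ⟨hs0, hs1⟩ := hs
    have e := X_eq s
    have x0 : 0 ≤ X s := by
      by_contra! h
      have e1 : A (X s) < α 0 := unitExtend_lt h
      have e2 : B 0 ≤ B (2 * s - X s) := mB (by linarith)
      linarith
    have x1 : X s ≤ 1 := by
      by_contra! h
      have e1 : α 1 < A (X s) := lt_unitExtend h
      have e2 : B (2 * s - X s) ≤ B 1 := mB (by linarith)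
      linarith
    have y0 : 0 ≤ 2 * s - X s := by
      by_contra! h
      have e1 : B (2 * s - X s) < β 0 := unitExtend_lt h
      have e2 : A 0 ≤ A (X s) := mA x0
      linarith
    have y1 : 2 * s - X s ≤ 1 := by
      by_contra! h
      have e1 : β 1 < B (2 * s - X s) := lt_unitExtend h
      have e2 : A (X s) ≤ A 1 := mA x1
      linarith
    exact ⟨⟨x0, x1⟩, y0, y1⟩
  obtain ⟨⟨k1, _⟩, k2, _⟩ := key 0 (by simp)
  obtain ⟨⟨_, k3⟩, _, k4⟩ := key 1 (by simp)
  refine ⟨X, fun s => 2 * s - X s, X_cont, by fun_prop, X_mono, ?_, by linarith, by linarith,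
    by linarith, by linarith, fun s hs => ?_⟩
  · intro s s' h
    have := X_lip h
    change 2 * s - X s ≤ 2 * s' - X s'
    linarith
  · obtain ⟨h1, h2⟩ := key s hs
    refine ⟨h1, h2, ?_⟩
    rw [← unitExtend_of_mem (α := α) h1, ← unitExtend_of_mem (α := β) h2]
    exact X_eq s

namespace FrechetMatched

variable {r r' a b c d : ℝ} {f g : ℝ → ℝ}

lemma symm (h : FrechetMatched r f a b g c d) : FrechetMatched r g c d f a b := by
  obtain ⟨φ, ψ, cφ, cψ, mφ, mψ, φ0, φ1, ψ0, ψ1, hr⟩ := h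
  exact ⟨ψ, φ, cψ, cφ, mψ, mφ, ψ0, ψ1, φ0, φ1, fun s hs => abs_sub_comm (g _) (f _) ▸ hr s hs⟩

lemma mono (h : FrechetMatched r f a b g c d) (hr : r ≤ r') : FrechetMatched r' f a b g c d := by
  obtain ⟨φ, ψ, cφ, cψ, mφ, mψ, φ0, φ1, ψ0, ψ1, hh⟩ := h
  exact ⟨φ, ψ, cφ, cψ, mφ, mψ, φ0, φ1, ψ0, ψ1, fun s hs => (hh s hs).trans hr⟩

lemma neg (h : FrechetMatched r f a b g c d) :
    FrechetMatched r (fun s => -f s) a b (fun s => -g s) c d := by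
  obtain ⟨φ, ψ, cφ, cψ, mφ, mψ, φ0, φ1, ψ0, ψ1, hh⟩ := h
  refine ⟨φ, ψ, cφ, cψ, mφ, mψ, φ0, φ1, ψ0, ψ1, fun s hs => ?_⟩
  rw [neg_sub_neg, abs_sub_comm]
  exact hh s hs

lemma add_const (h : FrechetMatched r f a b g c d) (z : ℝ) :
    FrechetMatched r (fun s => f s + z) a b (fun s => g s + z) c d := by
  obtain ⟨φ, ψ, cφ, cψ, mφ, mψ, φ0, φ1, ψ0, ψ1, hh⟩ := h
  refine ⟨φ, ψ, cφ, cψ, mφ, mψ, φ0, φ1, ψ0, ψ1, fun s hs => ?_⟩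
  rw [add_sub_add_right_eq_sub]
  exact hh s hs

lemma trans {h : ℝ → ℝ} {u v : ℝ} (h₁ : FrechetMatched r f a b g c d)
    (h₂ : FrechetMatched r' g c d h u v) : FrechetMatched (r + r') f a b h u v := by
  obtain ⟨φ, ψ, cφ, cψ, mφ, mψ, φ0, φ1, ψ0, ψ1, hh⟩ := h₁
  obtain ⟨φ', ψ', cφ', cψ', mφ', mψ', φ0', φ1', ψ0', ψ1', hh'⟩ := h₂
  obtain ⟨x, y, cx, cy, mx, my, x0, x1, y0, y1, hxy⟩ :=
    exists_reparam_eq cψ cφ' mψ mφ' (ψ0.trans φ0'.symm) (ψ1.trans φ1'.symm)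
  refine ⟨φ ∘ x, ψ' ∘ y, cφ.comp cx, cψ'.comp cy, mφ.comp mx, mψ'.comp my, ?_, ?_, ?_, ?_, ?_⟩
  · simp [x0, φ0]
  · simp [x1, φ1]
  · simp [y0, ψ0']
  · simp [y1, ψ1']
  · intro s hs
    obtain ⟨hx, hy, e⟩ := hxy s hs
    have e1 := hh _ hx
    have e2 := hh' _ hy
    rw [e] at e1
    exact (abs_sub_le _ _ _).trans (add_le_add e1 e2)

lemma concat {b' d' : ℝ} (h₁ : FrechetMatched r f a b g c d)
    (h₂ : FrechetMatched r f b b' g d d') : FrechetMatched r f a b' g c d' := by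
  obtain ⟨φ, ψ, cφ, cψ, mφ, mψ, φ0, φ1, ψ0, ψ1, hh⟩ := h₁
  obtain ⟨φ', ψ', cφ', cψ', mφ', mψ', φ0', φ1', ψ0', ψ1', hh'⟩ := h₂
  have mono_join {χ χ' : ℝ → ℝ} (m : Monotone χ) (m' : Monotone χ') (e : ℝ) :
      Monotone fun s => χ (min (2 * s) 1) + χ' (max (2 * s - 1) 0) - e := fun s s' hs =>
    sub_le_sub_right (add_le_add (m (min_le_min (by linarith) le_rfl))
      (m' (max_le_max (by linarith) le_rfl))) e
  refine ⟨fun s => φ (min (2 * s) 1) + φ' (max (2 * s - 1) 0) - b,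
    fun s => ψ (min (2 * s) 1) + ψ' (max (2 * s - 1) 0) - d, by fun_prop, by fun_prop,
    mono_join mφ mφ' b, mono_join mψ mψ' d, ?_, ?_, ?_, ?_, ?_⟩
  · simp [φ0, φ0']
  · norm_num [φ1, φ1']
  · simp [ψ0, ψ0']
  · norm_num [ψ1, ψ1']
  · rintro s ⟨hs0, hs1⟩
    rcases le_total (2 * s) 1 with h | h
    · simpa [min_eq_left h, max_eq_right (sub_nonpos.2 h), φ0', ψ0'] using
        hh (2 * s) ⟨by linarith, h⟩
    · simpa [min_eq_right h, max_eq_left (sub_nonneg.2 h), φ1, ψ1] using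
        hh' (2 * s - 1) ⟨by linarith, by linarith⟩

lemma of_constant_left (hcd : c ≤ d) (h : ∀ s ∈ Set.Icc c d, |f a - g s| ≤ r) :
    FrechetMatched r f a a g c d := by
  refine ⟨fun _ => a, fun s => c + s * (d - c), by fun_prop, by fun_prop, monotone_const, ?_, rfl,
    rfl, by ring, by ring, fun s hs => h _ ⟨?_, ?_⟩⟩
  · intro s s' hs
    have := mul_le_mul_of_nonneg_right hs (sub_nonneg.2 hcd)
    simpa using this
  · nlinarith [hs.1]
  · nlinarith [hs.2]

lemma of_forall (hab : a ≤ b) (h : ∀ s ∈ Set.Icc a b, |f s - g s| ≤ r) :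
    FrechetMatched r f a b g a b := by
  have mono_aff : Monotone fun s : ℝ => a + s * (b - a) := fun s s' hs => by
    have := mul_le_mul_of_nonneg_right hs (sub_nonneg.2 hab)
    simpa using this
  refine ⟨fun s => a + s * (b - a), fun s => a + s * (b - a), by fun_prop, by fun_prop, mono_aff,
    mono_aff, by ring, by ring, by ring, by ring, fun s hs => h _ ⟨?_, ?_⟩⟩
  · nlinarith [hs.1]
  · nlinarith [hs.2]

lemma of_monotoneOn (hab : a ≤ b) (hcd : c ≤ d) (cf : ContinuousOn f (Set.Icc a b))
    (cg : ContinuousOn g (Set.Icc c d)) (mf : MonotoneOn f (Set.Icc a b))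
    (mg : MonotoneOn g (Set.Icc c d)) (h0 : f a = g c) (h1 : f b = g d) :
    FrechetMatched 0 f a b g c d := by
  have aff_mono {a b : ℝ} (hab : a ≤ b) : Monotone fun s : ℝ => a + s * (b - a) :=
    fun s s' hs => by simpa using mul_le_mul_of_nonneg_right hs (sub_nonneg.2 hab)
  have aff_mem {a b : ℝ} (hab : a ≤ b) (s : ℝ) :
      a + clampUnit s * (b - a) ∈ Set.Icc a b := by
    obtain ⟨k1, k2⟩ := clampUnit_mem s
    constructor <;> nlinarith
  have ext_cont {f : ℝ → ℝ} {a b : ℝ} (hab : a ≤ b) (cf : ContinuousOn f (Set.Icc a b)) :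
      Continuous fun s => f (a + clampUnit s * (b - a)) :=
    cf.comp_continuous (by have := continuous_clampUnit; fun_prop) (aff_mem hab)
  have ext_mono {f : ℝ → ℝ} {a b : ℝ} (hab : a ≤ b) (mf : MonotoneOn f (Set.Icc a b)) :
      Monotone fun s => f (a + clampUnit s * (b - a)) := fun s s' hs =>
    mf (aff_mem hab s) (aff_mem hab s') (aff_mono hab (monotone_clampUnit hs))
  have c0 : clampUnit 0 = 0 := clampUnit_of_mem (by simp)
  have c1 : clampUnit 1 = 1 := clampUnit_of_mem (by simp)
  obtain ⟨x, y, cx, cy, mx, my, x0, x1, y0, y1, hxy⟩ :=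
    exists_reparam_eq (ext_cont hab cf) (ext_cont hcd cg) (ext_mono hab mf) (ext_mono hcd mg)
      (by simp [c0, h0]) (by simp [c1, h1])
  refine ⟨fun s => a + x s * (b - a), fun s => c + y s * (d - c), by fun_prop, by fun_prop,
    (aff_mono hab).comp mx, (aff_mono hcd).comp my, by simp [x0], by simp [x1], by simp [y0],
    by simp [y1], fun s hs => ?_⟩
  obtain ⟨hx, hy, e⟩ := hxy s hs
  rw [clampUnit_of_mem hx, clampUnit_of_mem hy] at e
  simp [e]

lemma of_antitoneOn (hab : a ≤ b) (hcd : c ≤ d) (cf : ContinuousOn f (Set.Icc a b))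
    (cg : ContinuousOn g (Set.Icc c d)) (mf : AntitoneOn f (Set.Icc a b))
    (mg : AntitoneOn g (Set.Icc c d)) (h0 : f a = g c) (h1 : f b = g d) :
    FrechetMatched 0 f a b g c d := by
  simpa using (of_monotoneOn hab hcd cf.neg cg.neg mf.neg mg.neg (by simp [h0])
    (by simp [h1])).neg

lemma frechetDist_le (h : FrechetMatched r f 0 1 g 0 1) : frechetDist f g ≤ r := by
  obtain ⟨φ, ψ, cφ, cψ, mφ, mψ, φ0, φ1, ψ0, ψ1, hh⟩ := h
  refine csInf_le ⟨0, ?_⟩ ⟨φ, ψ, cφ.continuousOn, cψ.continuousOn, mφ.monotoneOn _,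
    mψ.monotoneOn _, φ0, φ1, ψ0, ψ1, hh⟩
  rintro s ⟨φ, ψ, -, -, -, -, -, -, -, -, hs⟩
  exact dist_nonneg.trans (hs 0 (by simp))

end FrechetMatched

/-- A continuous function on `[a, b]` has a continuous running maximum. -/
lemma exists_running_max {f : ℝ → ℝ} {a b : ℝ} (hab : a ≤ b) (cf : ContinuousOn f (Set.Icc a b)) :
    ∃ M : ℝ → ℝ, ContinuousOn M (Set.Icc a b) ∧ MonotoneOn M (Set.Icc a b) ∧
      ∀ s ∈ Set.Icc a b, f s ≤ M s ∧ ∃ u ∈ Set.Icc a s, M s = f u := by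
  have cF : Continuous (Set.IccExtend hab ((Set.Icc a b).domRestrict f)) :=
    cf.domRestrict.Icc_extend'
  set F := Set.IccExtend hab ((Set.Icc a b).domRestrict f) with hF
  have F_eq {x : ℝ} (hx : x ∈ Set.Icc a b) : F x = f x := by
    rw [hF, Set.IccExtend_of_mem _ _ hx]; rfl
  let M : ℝ → ℝ := fun s => sSup ((fun u => F (min u s)) '' Set.Icc a b)
  have cM : Continuous M := by
    refine isCompact_Icc.continuous_sSup (f := fun s u => F (min u s)) ?_
    exact cF.comp (continuous_snd.min continuous_fst)
  have attained (s : ℝ) : ∃ u ∈ Set.Icc a b, M s = F (min u s) :=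
    isCompact_Icc.exists_sSup_image_eq (Set.nonempty_Icc.2 hab) (by fun_prop)
  have le_M {s u : ℝ} (hu : u ∈ Set.Icc a b) (hus : u ≤ s) : F u ≤ M s := by
    refine le_csSup (isCompact_Icc.bddAbove_image (by fun_prop)) ⟨u, hu, ?_⟩
    simp [min_eq_left hus]
  have min_mem {u s : ℝ} (hu : u ∈ Set.Icc a b) (hs : s ∈ Set.Icc a b) :
      min u s ∈ Set.Icc a b := ⟨le_min hu.1 hs.1, (min_le_left _ _).trans hu.2⟩
  refine ⟨M, cM.continuousOn, fun s hs s' hs' hss => ?_, fun s hs => ⟨?_, ?_⟩⟩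
  · obtain ⟨u, hu, e⟩ := attained s
    rw [e]
    exact le_M (min_mem hu hs) ((min_le_right _ _).trans hss)
  · rw [← F_eq hs]
    exact le_M hs le_rfl
  · obtain ⟨u, hu, e⟩ := attained s
    exact ⟨min u s, ⟨le_min hu.1 hs.1, min_le_right _ _⟩, e.trans (F_eq (min_mem hu hs))⟩

/-- A curve that decreases by at most `2 * δ` and leaves the range of its end values by at most `δ`
is matched within `δ` to a monotone curve with the same end values. -/
lemma frechetMatched_of_almost_monotone {δ a b c d : ℝ} {f g : ℝ → ℝ} (hδ : 0 ≤ δ) (hab : a ≤ b)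
    (hcd : c ≤ d) (cf : ContinuousOn f (Set.Icc a b)) (cg : ContinuousOn g (Set.Icc c d))
    (mg : MonotoneOn g (Set.Icc c d)) (h0 : f a = g c) (h1 : f b = g d)
    (hrange : ∀ s ∈ Set.Icc a b, f a - δ ≤ f s ∧ f s ≤ f b + δ)
    (hdir : ∀ x y, a ≤ x → x ≤ y → y ≤ b → f x - f y ≤ 2 * δ) :
    FrechetMatched δ f a b g c d := by
  obtain ⟨M, cM, mM, hM⟩ := exists_running_max hab cf
  have hle : f a ≤ f b := by
    rw [h0, h1]; exact mg ⟨le_rfl, hcd⟩ ⟨hcd, le_rfl⟩ hcd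
  let H : ℝ → ℝ := fun s => max (f a) (M s - δ)
  have cH : ContinuousOn H (Set.Icc a b) := continuousOn_const.sup (cM.sub continuousOn_const)
  have mH : MonotoneOn H (Set.Icc a b) := fun x hx y hy hxy =>
    max_le_max le_rfl (sub_le_sub_right (mM hx hy hxy) δ)
  have Ha : H a = f a := by
    obtain ⟨-, u, hu, e⟩ := hM a ⟨le_rfl, hab⟩
    obtain rfl : u = a := le_antisymm hu.2 hu.1
    exact max_eq_left (by linarith)
  have Hb_le : H b ≤ f b := by
    obtain ⟨-, u, hu, e⟩ := hM b ⟨hab, le_rfl⟩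
    exact max_le hle (by linarith [(hrange u hu).2])
  have Hb_ge : f b - δ ≤ H b :=
    le_max_of_le_right (sub_le_sub_right (hM b ⟨hab, le_rfl⟩).1 δ)
  obtain ⟨e, he, hge⟩ : H b ∈ g '' Set.Icc c d :=
    intermediate_value_Icc hcd cg ⟨by rw [← h0]; exact le_max_left _ _, by rw [← h1]; exact Hb_le⟩
  have near : ∀ s ∈ Set.Icc a b, |f s - H s| ≤ δ := by
    intro s hs
    obtain ⟨h2, u, hu, e2⟩ := hM s hs
    have h3 := hdir u s hu.1 hu.2 hs.2
    have h4 := (hrange s hs).1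
    rw [abs_le]
    rcases max_cases (f a) (M s - δ) with ⟨h5, h6⟩ | ⟨h5, h6⟩ <;>
      simp only [H, h5] <;> constructor <;> linarith
  have first : FrechetMatched δ f a b g c e := by
    simpa using (FrechetMatched.of_forall hab near).trans
      (FrechetMatched.of_monotoneOn hab he.1 cH (cg.mono (Set.Icc_subset_Icc_right he.2)) mH
        (mg.mono (Set.Icc_subset_Icc_right he.2)) (Ha.trans h0) hge.symm)
  refine first.concat (FrechetMatched.of_constant_left he.2 fun s hs => ?_)
  have hs' : s ∈ Set.Icc c d := ⟨he.1.trans hs.1, hs.2⟩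
  have h2 := mg he hs' hs.1
  have h3 := mg hs' ⟨hcd, le_rfl⟩ hs.2
  rw [abs_le]
  constructor <;> linarith

/-- `f` on `[a, b]` runs through the values of the list in order, continuously and monotonically
between consecutive values. -/
def TracesList (f : ℝ → ℝ) : ℝ → ℝ → List ℝ → Prop
  | _, _, [] => False
  | a, b, [x] => a = b ∧ f a = x
  | a, b, x :: y :: l => f a = x ∧ ∃ c, a ≤ c ∧ f c = y ∧ ContinuousOn f (Set.Icc a c) ∧
      (MonotoneOn f (Set.Icc a c) ∨ AntitoneOn f (Set.Icc a c)) ∧ TracesList f c b (y :: l)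

lemma TracesList.head_eq {f : ℝ → ℝ} {a b x : ℝ} {l : List ℝ} (h : TracesList f a b (x :: l)) :
    f a = x := by
  cases l with
  | nil => exact h.2
  | cons y l => exact h.1

lemma monotoneOn_of_monotoneOn_or_antitoneOn {f : ℝ → ℝ} {a c : ℝ}
    (h : MonotoneOn f (Set.Icc a c) ∨ AntitoneOn f (Set.Icc a c)) (hf : f a ≤ f c) :
    MonotoneOn f (Set.Icc a c) := by
  rcases h with h | h
  · exact h
  · intro x hx y hy _
    have hac : a ≤ c := hx.1.trans hx.2
    have h1 := h ⟨le_rfl, hac⟩ hx hx.1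
    have h2 := h hy ⟨hac, le_rfl⟩ hy.2
    linarith

lemma antitoneOn_of_monotoneOn_or_antitoneOn {f : ℝ → ℝ} {a c : ℝ}
    (h : MonotoneOn f (Set.Icc a c) ∨ AntitoneOn f (Set.Icc a c)) (hf : f c ≤ f a) :
    AntitoneOn f (Set.Icc a c) := by
  rcases h with h | h
  · intro x hx y hy _
    have hac : a ≤ c := hx.1.trans hx.2
    have h1 := h ⟨le_rfl, hac⟩ hx hx.1
    have h2 := h hy ⟨hac, le_rfl⟩ hy.2
    linarith
  · exact h

lemma TracesList.vertexSeq {f : ℝ → ℝ} {a b : ℝ} {l : List ℝ} (h : TracesList f a b l) :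
    TracesList f a b (vertexSeq l) := by
  induction l using vertexSeq.induct generalizing a with
  | case1 => exact h.elim
  | case2 x => simpa [_root_.vertexSeq] using h
  | case3 x y => simpa [_root_.vertexSeq] using h
  | case4 x y v l hxyz ih =>
    rw [_root_.vertexSeq, if_pos hxyz]
    obtain ⟨ha, c, hac, hc, cont, mon, -, e, hce, he, cont', mon', tail⟩ := h
    refine ih ⟨ha, e, hac.trans hce, he, ?_, ?_, tail⟩
    · rw [← Set.Icc_union_Icc_eq_Icc hac hce]
      exact cont.union_of_isClosed cont' isClosed_Icc isClosed_Icc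
    · rw [← Set.Icc_union_Icc_eq_Icc hac hce]
      rcases hxyz with ⟨h1, h2⟩ | ⟨h1, h2⟩
      · exact .inl <|
          (monotoneOn_of_monotoneOn_or_antitoneOn mon (by rw [ha, hc]; exact h1)).union_right
          (monotoneOn_of_monotoneOn_or_antitoneOn mon' (by rw [hc, he]; exact h2))
          (isGreatest_Icc hac) (isLeast_Icc hce)
      · exact .inr <|
          (antitoneOn_of_monotoneOn_or_antitoneOn mon (by rw [ha, hc]; exact h2)).union_right
          (antitoneOn_of_monotoneOn_or_antitoneOn mon' (by rw [hc, he]; exact h1))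
          (isGreatest_Icc hac) (isLeast_Icc hce)
  | case5 x y v l hxyz ih =>
    rw [_root_.vertexSeq, if_neg hxyz]
    obtain ⟨ha, c, hac, hc, cont, mon, tail⟩ := h
    have tail' := ih tail
    cases hl : _root_.vertexSeq (y :: v :: l) with
    | nil => rw [hl] at tail'; exact tail'.elim
    | cons y' l' =>
      rw [hl] at tail'
      exact ⟨ha, c, hac, tail'.head_eq, cont, mon, tail'⟩

lemma TracesList.frechetMatched {f g : ℝ → ℝ} {a b c d : ℝ} {l : List ℝ}
    (hf : TracesList f a b l) (hg : TracesList g c d l) : FrechetMatched 0 f a b g c d := by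
  induction l generalizing a c with
  | nil => exact hf.elim
  | cons x l ih =>
    cases l with
    | nil =>
      obtain ⟨rfl, hf⟩ := hf
      obtain ⟨rfl, hg⟩ := hg
      refine FrechetMatched.of_constant_left le_rfl fun s hs => ?_
      obtain rfl : s = c := le_antisymm hs.2 hs.1
      simp [hf, hg]
    | cons y l =>
      obtain ⟨hfa, u, hau, hfu, cf, mf, tf⟩ := hf
      obtain ⟨hgc, v, hcv, hgv, cg, mg, tg⟩ := hg
      refine FrechetMatched.concat ?_ (ih tf tg)
      rcases le_total x y with h | h
      · exact .of_monotoneOn hau hcv cf cg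
          (monotoneOn_of_monotoneOn_or_antitoneOn mf (by rw [hfa, hfu]; exact h))
          (monotoneOn_of_monotoneOn_or_antitoneOn mg (by rw [hgc, hgv]; exact h))
          (hfa.trans hgc.symm) (hfu.trans hgv.symm)
      · exact .of_antitoneOn hau hcv cf cg
          (antitoneOn_of_monotoneOn_or_antitoneOn mf (by rw [hfa, hfu]; exact h))
          (antitoneOn_of_monotoneOn_or_antitoneOn mg (by rw [hgc, hgv]; exact h))
          (hfa.trans hgc.symm) (hfu.trans hgv.symm)

/-- Piecewise linear interpolation of a sequence at the natural numbers. -/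
noncomputable def natInterp (v : ℕ → ℝ) (s : ℝ) : ℝ :=
  v ⌊s⌋₊ + (s - ⌊s⌋₊) * (v (⌊s⌋₊ + 1) - v ⌊s⌋₊)

section natInterp

variable (v : ℕ → ℝ) (i : ℕ)

lemma natInterp_natCast : natInterp v i = v i := by simp [natInterp]

lemma natInterp_natCast_add_one : natInterp v (i + 1) = v (i + 1) := by
  exact_mod_cast natInterp_natCast v (i + 1)

lemma natInterp_of_mem {s : ℝ} (hs : s ∈ Set.Icc (i : ℝ) (i + 1)) :
    natInterp v s = v i + (s - i) * (v (i + 1) - v i) := by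
  rcases hs.2.eq_or_lt with rfl | h
  · rw [natInterp_natCast_add_one]; ring
  · have : ⌊s⌋₊ = i := (Nat.floor_eq_iff (i.cast_nonneg.trans hs.1)).2 ⟨hs.1, h⟩
    rw [natInterp, this]

lemma continuousOn_natInterp : ContinuousOn (natInterp v) (Set.Icc (i : ℝ) (i + 1)) :=
  ContinuousOn.congr (f := fun s => v i + (s - i) * (v (i + 1) - v i)) (by fun_prop)
    fun _ hs => natInterp_of_mem v i hs

variable {v i}

lemma monotoneOn_natInterp (h : v i ≤ v (i + 1)) :
    MonotoneOn (natInterp v) (Set.Icc (i : ℝ) (i + 1)) := fun s hs s' hs' hss => by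
  rw [natInterp_of_mem v i hs, natInterp_of_mem v i hs']
  nlinarith

lemma antitoneOn_natInterp (h : v (i + 1) ≤ v i) :
    AntitoneOn (natInterp v) (Set.Icc (i : ℝ) (i + 1)) := fun s hs s' hs' hss => by
  rw [natInterp_of_mem v i hs, natInterp_of_mem v i hs']
  nlinarith

lemma tracesList_natInterp (v : ℕ → ℝ) (n i : ℕ) :
    TracesList (natInterp v) i (i + n : ℕ) ((List.range' i (n + 1)).map v) := by
  induction n generalizing i with
  | zero => exact ⟨by simp, natInterp_natCast v i⟩
  | succ n ih =>
    have := ih (i + 1)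
    rw [List.range'_succ, List.map_cons] at this ⊢
    rw [List.range'_succ, List.map_cons]
    refine ⟨natInterp_natCast v i, i + 1, by linarith, natInterp_natCast_add_one v i,
      continuousOn_natInterp v i, ?_, ?_⟩
    · exact (le_total (v i) (v (i + 1))).imp monotoneOn_natInterp antitoneOn_natInterp
    · rw [show i + (n + 1) = i + 1 + n by ring]
      exact_mod_cast this

lemma abs_natInterp_sub_le {v v' : ℕ → ℝ} {r : ℝ} (h : ∀ i, |v i - v' i| ≤ r) {s : ℝ}
    (hs : 0 ≤ s) : |natInterp v s - natInterp v' s| ≤ r := by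
  have h1 := Nat.floor_le hs
  have h2 := (Nat.lt_floor_add_one s).le
  have h3 := abs_le.1 (h ⌊s⌋₊)
  have h4 := abs_le.1 (h (⌊s⌋₊ + 1))
  rw [natInterp, natInterp, abs_le]
  constructor <;> nlinarith

/-- Matchings of the edges of an interpolated sequence join to a matching of the whole. -/
lemma frechetMatched_natInterp {f : ℝ → ℝ} {p : ℕ → ℝ} {r : ℝ} (hr : 0 ≤ r) {n : ℕ}
    (h0 : f (p 0) = v 0)
    (h : ∀ i < n, FrechetMatched r f (p i) (p (i + 1)) (natInterp v) i (i + 1)) :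
    FrechetMatched r f (p 0) (p n) (natInterp v) 0 n := by
  induction n with
  | zero =>
    rw [Nat.cast_zero]
    refine FrechetMatched.of_constant_left le_rfl fun s hs => ?_
    obtain rfl : s = 0 := le_antisymm hs.2 hs.1
    have := natInterp_natCast v 0
    rw [Nat.cast_zero] at this
    simpa [this, h0] using hr
  | succ n ih =>
    push_cast
    exact (ih fun i hi => h i (by omega)).concat (h n (by omega))

end natInterp

lemma IsPolylineOn.frechetMatched {τ : ℝ → ℝ} {m : ℕ} {t : ℕ → ℝ} (h : IsPolylineOn τ m t) :
    FrechetMatched 0 τ 0 1 (natInterp fun i => τ (t i)) 0 m := by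
  obtain ⟨h0, h1, hlt, hlin⟩ := h
  have := frechetMatched_natInterp (f := τ) (p := t) (v := fun i => τ (t i)) (n := m) le_rfl rfl
    fun i hi => ?_
  · rwa [h0, h1] at this
  have hpos : 0 < t (i + 1) - t i := sub_pos.2 (hlt i hi)
  refine ⟨fun s => t i + s * (t (i + 1) - t i), fun s => i + s, by fun_prop, by fun_prop,
    fun s s' hs => ?_, fun s s' hs => by simpa using hs, by ring, by ring, by ring, by ring,
    fun s hs => ?_⟩
  · simpa using mul_le_mul_of_nonneg_right hs hpos.le
  · rw [hlin i hi _ (by nlinarith [hs.1]) (by nlinarith [hs.2]),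
      natInterp_of_mem _ i ⟨by linarith [hs.1], by linarith [hs.2]⟩]
    simp [hpos.ne']

namespace IsDeltaSignature

variable {δ : ℝ} {π : ℝ → ℝ} {ℓ : ℕ} {p : ℕ → ℝ}

/-- Between two consecutive signature parameters the curve stays within `δ` of the range of the
signature edge. -/
lemma range_edge (h : IsDeltaSignature δ π ℓ p) (hδ : 0 ≤ δ) {i : ℕ} (hi : i < ℓ) {s : ℝ}
    (hs : s ∈ Set.Icc (p i) (p (i + 1))) :
    min (π (p i)) (π (p (i + 1))) - δ ≤ π s ∧ π s ≤ max (π (p i)) (π (p (i + 1))) + δ := by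
  suffices π s ∈ Set.uIcc (π (p i)) (π (p (i + 1))) ∪ Set.Icc (π (p i) - δ) (π (p i) + δ)
      ∪ Set.Icc (π (p (i + 1)) - δ) (π (p (i + 1)) + δ) by
    have h1 := min_le_left (π (p i)) (π (p (i + 1)))
    have h2 := min_le_right (π (p i)) (π (p (i + 1)))
    have h3 := le_max_left (π (p i)) (π (p (i + 1)))
    have h4 := le_max_right (π (p i)) (π (p (i + 1)))
    rcases this with (⟨h5, h6⟩ | ⟨h5, h6⟩) | ⟨h5, h6⟩
    · exact ⟨by linarith, by linarith⟩
    · constructor <;> linarith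
    · constructor <;> linarith
  rcases (show ℓ = 1 ∨ 2 ≤ ℓ by have := h.one_le; omega) with rfl | hℓ
  · obtain rfl : i = 0 := by omega
    exact h.range_single rfl s (h.start ▸ hs.1) (h.finish ▸ hs.2)
  rcases Nat.eq_zero_or_pos i with rfl | hpos
  · exact .inl (h.range_first hℓ s hs.1 hs.2)
  rcases (show i + 1 = ℓ ∨ i ≤ ℓ - 2 by omega) with rfl | hi'
  · exact (h.range_last hℓ s hs.1 hs.2).imp .inl id
  · exact .inl (.inl (h.range_int i hpos hi' s hs.1 hs.2))

lemma param_mem (h : IsDeltaSignature δ π ℓ p) {i : ℕ} (hi : i ≤ ℓ) :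
    p i ∈ Set.Icc (0:ℝ) 1 := by
  have mono {a b : ℕ} (hab : a ≤ b) (hb : b ≤ ℓ) : p a ≤ p b := by
    induction b, hab using Nat.le_induction with
    | base => exact le_rfl
    | succ b _ ih => exact (ih (by omega)).trans (h.mono b (by omega)).le
  exact ⟨h.start ▸ mono i.zero_le hi, h.finish ▸ mono hi le_rfl⟩

lemma edge_ne (h : IsDeltaSignature δ π ℓ p) (hδ : 0 ≤ δ) {i : ℕ} (hi : i < ℓ) :
    π (p i) ≠ π (p (i + 1)) := by
  intro e
  rcases (show (i = 0 ∨ i = ℓ - 1) ∨ (1 ≤ i ∧ i ≤ ℓ - 2) by omega) with hb | ⟨h1, h2⟩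
  · have := h.minedge_bnd i hi hb
    rw [e, sub_self, abs_zero] at this
    linarith
  · have := h.minedge_int i h1 h2
    rw [e, sub_self, abs_zero] at this
    linarith

/-- A curve is matched within `δ` to each of its `δ`-signatures. -/
lemma frechetMatched (h : IsDeltaSignature δ π ℓ p) (hδ : 0 ≤ δ)
    (hπ : ContinuousOn π (Set.Icc 0 1)) :
    FrechetMatched δ π 0 1 (natInterp fun i => π (p i)) 0 ℓ := by
  have := frechetMatched_natInterp (f := π) (p := p) (v := fun i => π (p i)) (n := ℓ) hδ rfl
    fun i hi => ?_
  · rwa [h.start, h.finish] at this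
  have cont : ContinuousOn π (Set.Icc (p i) (p (i + 1))) :=
    hπ.mono (Set.Icc_subset_Icc (h.param_mem hi.le).1 (h.param_mem hi).2)
  have cont' := continuousOn_natInterp (fun i => π (p i)) i
  have e0 := natInterp_natCast (fun i => π (p i)) i
  have e1 := natInterp_natCast_add_one (fun i => π (p i)) i
  have hi1 : (i : ℝ) ≤ i + 1 := by linarith
  rcases (h.edge_ne hδ hi).lt_or_gt with hlt | hlt
  · refine frechetMatched_of_almost_monotone hδ (h.mono i hi).le hi1 cont cont'
      (monotoneOn_natInterp hlt.le) e0.symm e1.symm (fun s hs => ?_) (h.dir_up i hi hlt)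
    simpa [min_eq_left hlt.le, max_eq_right hlt.le] using h.range_edge hδ hi hs
  · have := (frechetMatched_of_almost_monotone hδ (h.mono i hi).le hi1 cont.neg cont'.neg
      (antitoneOn_natInterp hlt.le).neg (by simp [e0]) (by simp [e1]) (fun s hs => ?_)
      fun x y hx hxy hy => ?_).neg
    · simpa using this
    · have := h.range_edge hδ hi hs
      rw [min_eq_right hlt.le, max_eq_left hlt.le] at this
      simp only [Pi.neg_apply]
      constructor <;> linarith [this.1, this.2]
    · have := h.dir_down i hi hlt x y hx hxy hy
      simp only [Pi.neg_apply]
      linarith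

end IsDeltaSignature

/-- Snapping to a grid of width `w` shifted by `z` moves each point by at most `w`, up to the
translation by `z`. -/
lemma abs_sub_snap_le {w : ℝ} (hw : 0 < w) (x z : ℝ) :
    |x - ((⌊(x - z) / w⌋ : ℝ) * w + z)| ≤ w := by
  have h1 := (le_div_iff₀ hw).1 (Int.floor_le ((x - z) / w))
  have h2 := (div_lt_iff₀ hw).1 (Int.lt_floor_add_one ((x - z) / w))
  rw [abs_le]
  constructor <;> linarith

/-- An interpolated sequence is matched within `w` to the interpolation of the snapped sequence. -/
lemma frechetMatched_natInterp_snap {w : ℝ} (hw : 0 < w) (z : ℝ) (v : ℕ → ℝ) (n : ℕ) :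
    FrechetMatched w (natInterp v) 0 n
      (fun s => natInterp (fun i => (⌊(v i - z) / w⌋ : ℝ) * w) s + z) 0 n := by
  refine FrechetMatched.of_forall n.cast_nonneg fun s hs => ?_
  have := abs_natInterp_sub_le (fun i => abs_sub_snap_le hw (v i) z) hs.1
  convert this using 3
  simp only [natInterp]
  ring

/-- if snapping the signature vertices of `π` and the vertices of `τ` to a
shifted grid of width `w` yields identical vertex sequences, then `d_F(π,τ) ≤ 2w + δ`. -/
theorem same_key_implies_near (δ w z : ℝ) (hδ : 0 ≤ δ) (hw : 0 < w)
    (π τ : ℝ → ℝ) (hπ : ContinuousOn π (Set.Icc 0 1))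
    (ℓ : ℕ) (p : ℕ → ℝ) (hsig : IsDeltaSignature δ π ℓ p)
    (m : ℕ) (t : ℕ → ℝ) (hτ : IsPolylineOn τ m t)
    (heq : vertexSeq ((List.range (ℓ + 1)).map
            (fun i => (⌊(π (p i) - z) / w⌋ : ℝ) * w))
        = vertexSeq ((List.range (m + 1)).map
            (fun i => (⌊(τ (t i) - z) / w⌋ : ℝ) * w))) :
    frechetDist π τ ≤ 2 * w + δ := by
  have traces (v : ℕ → ℝ) (n : ℕ) :
      TracesList (natInterp v) 0 n (vertexSeq ((List.range (n + 1)).map v)) := by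
    simpa [List.range_eq_range'] using (tracesList_natInterp v n 0).vertexSeq
  have hσ' := traces (fun i => (⌊(π (p i) - z) / w⌋ : ℝ) * w) ℓ
  rw [heq] at hσ'
  have snapped := (hσ'.frechetMatched (traces _ m)).add_const z
  have hσ := (hsig.frechetMatched hδ hπ).trans (frechetMatched_natInterp_snap hw z _ ℓ)
  have hτ' := (frechetMatched_natInterp_snap hw z _ m).symm.trans hτ.frechetMatched.symm
  exact (((hσ.trans snapped).trans hτ').mono (by linarith)).frechetDist_le
end

section
/- For sets $A, B \subseteq [U]$, define time series $\tilde{x}$ and $\tilde{y}$ as follows. For each $i \in [U]$: if $i \in A$ set $x_{2i-1} = 4i+4$, $x_{2i} = 4i$, else $x_{2i-1} = x_{2i} = 4i$; if $i \in B$ set $y_{2i-1} = y_{2i} = 4i$, else $y_{2i-1} = 4i+3$, $y_{2i} = 4i+1$. Let $\tilde{x} = \langle 0, x_1, \ldots, x_{2U}, 4U+5 \rangle$ and $\tilde{y} = \langle 0, y_1, \ldots, y_{2U}, 4U+5 \rangle$. Then: if $A \cap B = \emptyset$ then $d_F(\tilde{x}, \tilde{y}) \le 1$, and if $A \cap B \ne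 \emptyset$ then $d_F(\tilde{x}, \tilde{y}) \ge 2$. -/
open Set

/-- The time-series gadget of Alice for the lower-bound reduction. -/
noncomputable def xlist (U : ℕ) (A : Finset ℕ) : List ℝ :=
  ((0:ℝ) :: (List.range U).flatMap (fun j =>
    if j + 1 ∈ A then [((4 * (j + 1) + 4 : ℕ) : ℝ), ((4 * (j + 1) : ℕ) : ℝ)]
    else [((4 * (j + 1) : ℕ) : ℝ), ((4 * (j + 1) : ℕ) : ℝ)])) ++ [((4 * U + 5 : ℕ) : ℝ)]

/-- The time-series gadget of Bob for the lower-bound reduction. -/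
noncomputable def ylist (U : ℕ) (B : Finset ℕ) : List ℝ :=
  ((0:ℝ) :: (List.range U).flatMap (fun j =>
    if j + 1 ∈ B then [((4 * (j + 1) : ℕ) : ℝ), ((4 * (j + 1) : ℕ) : ℝ)]
    else [((4 * (j + 1) + 3 : ℕ) : ℝ), ((4 * (j + 1) + 1 : ℕ) : ℝ)])) ++ [((4 * U + 5 : ℕ) : ℝ)]

/-- The polygonal curve with vertices `X 0, X 1, …`, where vertex `k` has parameter `k`. -/
noncomputable def unitSpeedPolyline (X : ℕ → ℝ) (u : ℝ) : ℝ :=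
  (1 - (u - ⌊u⌋₊)) * X ⌊u⌋₊ + (u - ⌊u⌋₊) * X (⌊u⌋₊ + 1)

theorem unitSpeedPolyline_eq (X : ℕ → ℝ) {u : ℝ} {k : ℕ} (h₁ : (k : ℝ) ≤ u) (h₂ : u ≤ k + 1) :
    unitSpeedPolyline X u = (1 - (u - k)) * X k + (u - k) * X (k + 1) := by
  rcases h₂.lt_or_eq with h | h
  · have : ⌊u⌋₊ = k := (Nat.floor_eq_iff (k.cast_nonneg.trans h₁)).2 ⟨h₁, h⟩
    simp [unitSpeedPolyline, this]
  · have : ⌊u⌋₊ = k + 1 := by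
      rw [h]; exact_mod_cast Nat.floor_natCast (k + 1)
    rw [unitSpeedPolyline, this, h]
    push_cast
    ring

theorem unitSpeedPolyline_natCast (X : ℕ → ℝ) (k : ℕ) : unitSpeedPolyline X k = X k := by
  simp [unitSpeedPolyline]

theorem unitSpeedPolyline_mem (X : ℕ → ℝ) {S : Set ℝ} (hS : Convex ℝ S) {p q : ℕ}
    (hX : ∀ k, p ≤ k → k ≤ q → X k ∈ S) {u : ℝ} (hp : (p : ℝ) ≤ u) (hq : u ≤ q) :
    unitSpeedPolyline X u ∈ S := by
  have hu : 0 ≤ u := p.cast_nonneg.trans hp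
  have hk : p ≤ ⌊u⌋₊ := Nat.le_floor hp
  have hk' : ⌊u⌋₊ ≤ q := Nat.floor_le_of_le hq
  rcases hk'.lt_or_eq with h | h
  · have h₁ := Nat.floor_le hu
    have h₂ := Nat.lt_floor_add_one u
    exact hS (hX _ hk hk') (hX _ (by omega) h) (by linarith) (by linarith) (by ring)
  · have : u = q := le_antisymm hq (h ▸ Nat.floor_le hu)
    rw [this, unitSpeedPolyline_natCast]
    exact hX q (by omega) le_rfl

theorem exists_unitSpeedPolyline_eq (X : ℕ → ℝ) {k : ℕ} {v : ℝ} (h₁ : X k ≤ v)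
    (h₂ : v ≤ X (k + 1)) : ∃ u : ℝ, k ≤ u ∧ u ≤ k + 1 ∧ unitSpeedPolyline X u = v := by
  rcases (h₁.trans h₂).lt_or_eq with h | h
  · have hd : 0 < X (k + 1) - X k := by linarith
    have h₃ : 0 ≤ (v - X k) / (X (k + 1) - X k) := div_nonneg (by linarith) hd.le
    have h₄ : (v - X k) / (X (k + 1) - X k) ≤ 1 := (div_le_one hd).2 (by linarith)
    refine ⟨k + (v - X k) / (X (k + 1) - X k), by linarith, by linarith, ?_⟩
    rw [unitSpeedPolyline_eq X (k := k) (by linarith) (by linarith)]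
    field_simp
    ring
  · exact ⟨k, le_rfl, by linarith, by rw [unitSpeedPolyline_natCast]; linarith⟩

theorem polylineL_eq (l : List ℝ) {n : ℕ} (hl : l.length = n + 1) (hn : 0 < n) {s : ℝ}
    (h₀ : 0 ≤ s) (h₁ : s ≤ 1) :
    polylineL l s = unitSpeedPolyline (fun k => l.getD k 0) (s * n) := by
  have hsn : s * n ≤ n := mul_le_of_le_one_left n.cast_nonneg h₁
  have hs : 0 ≤ s * n := by positivity
  have hf := Nat.floor_le hs
  have hf' := Nat.lt_floor_add_one (s * n)
  have hle : ⌊s * n⌋₊ ≤ n := Nat.floor_le_of_le hsn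
  have key : ((min ⌊s * n⌋₊ (n - 1) : ℕ) : ℝ) ≤ s * n ∧
      s * n ≤ (min ⌊s * n⌋₊ (n - 1) : ℕ) + 1 := by
    rcases hle.lt_or_eq with h | h
    · rw [min_eq_left (by omega)]
      exact ⟨hf, hf'.le⟩
    · rw [min_eq_right (by omega), Nat.cast_sub hn]
      have : (n : ℝ) ≤ s * n := by rwa [h] at hf
      push_cast
      constructor <;> linarith
  have hmin : min ⌊s * n⌋₊ (n - 1) + 1 ≤ n := by omega
  rw [unitSpeedPolyline_eq _ key.1 key.2]
  unfold polylineL polyline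
  simp only [hl, Nat.add_sub_cancel, smul_eq_mul]
  rw [min_eq_left (by omega : min ⌊s * n⌋₊ (n - 1) ≤ n), min_eq_left hmin]

/-- The parameter pair `(a, b)` is reachable from `(0, 0)` by a continuous monotone traversal
of `f` and `g` along which the two curves stay within distance `r`. -/
def FrechetReachable (f g : ℝ → ℝ) (r a b : ℝ) : Prop :=
  ∃ (T : ℝ) (φ ψ : ℝ → ℝ), 0 ≤ T ∧ Continuous φ ∧ Continuous ψ ∧ Monotone φ ∧ Monotone ψ ∧
    φ 0 = 0 ∧ ψ 0 = 0 ∧ φ T = a ∧ ψ T = b ∧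
    ∀ t ∈ Set.Icc 0 T, |f (φ t) - g (ψ t)| ≤ r

theorem FrechetReachable.zero {f g : ℝ → ℝ} {r : ℝ} (h : |f 0 - g 0| ≤ r) :
    FrechetReachable f g r 0 0 := by
  refine ⟨0, fun _ => 0, fun _ => 0, le_rfl, continuous_const, continuous_const,
    monotone_const, monotone_const, rfl, rfl, rfl, rfl, fun _ _ => h⟩

theorem FrechetReachable.dist_le {f g : ℝ → ℝ} {r a b : ℝ} (h : FrechetReachable f g r a b) :
    |f a - g b| ≤ r := by
  obtain ⟨T, φ, ψ, hT, -, -, -, -, -, -, rfl, rfl, h⟩ := h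
  exact h T ⟨hT, le_rfl⟩

theorem FrechetReachable.step {X Y : ℕ → ℝ} {r a b a' b' : ℝ}
    (h : FrechetReachable (unitSpeedPolyline X) (unitSpeedPolyline Y) r a b) {k l : ℕ}
    (hka : k ≤ a) (haa : a ≤ a') (hak : a' ≤ k + 1) (hlb : l ≤ b) (hbb : b ≤ b')
    (hbl : b' ≤ l + 1) (hr : |unitSpeedPolyline X a' - unitSpeedPolyline Y b'| ≤ r) :
    FrechetReachable (unitSpeedPolyline X) (unitSpeedPolyline Y) r a' b' := by
  have hr₀ := h.dist_le
  obtain ⟨T, φ, ψ, hT, hφ, hψ, mφ, mψ, φ0, ψ0, φT, ψT, hd⟩ := h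
  have mono (c : ℝ) (hc : 0 ≤ c) (χ : ℝ → ℝ) (hχ : Monotone χ) :
      Monotone fun t => χ (min t T) + max 0 (t - T) * c := by
    intro s t hst
    have := hχ (min_le_min_right T hst)
    dsimp only
    gcongr
  refine ⟨T + 1, fun t => φ (min t T) + max 0 (t - T) * (a' - a),
    fun t => ψ (min t T) + max 0 (t - T) * (b' - b), by linarith, by fun_prop, by fun_prop,
    mono _ (by linarith) _ mφ, mono _ (by linarith) _ mψ, ?_, ?_, ?_, ?_, ?_⟩
  · simp [hT, φ0]
  · simp [hT, ψ0]
  · simp [φT]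
  · simp [ψT]
  · rintro t ⟨ht₀, ht₁⟩
    rcases le_total t T with ht | ht
    · simpa [ht] using hd t ⟨ht₀, ht⟩
    · obtain ⟨w, rfl⟩ : ∃ w, t = T + w := ⟨t - T, by ring⟩
      have hw₀ : 0 ≤ w := by linarith
      have hw₁ : w ≤ 1 := by linarith
      simp only [min_eq_right ht, φT, ψT, add_sub_cancel_left, max_eq_right hw₀]
      have ha₁ : 0 ≤ w * (a' - a) := mul_nonneg hw₀ (by linarith)
      have ha₂ : w * (a' - a) ≤ a' - a := mul_le_of_le_one_left (by linarith) hw₁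
      have hb₁ : 0 ≤ w * (b' - b) := mul_nonneg hw₀ (by linarith)
      have hb₂ : w * (b' - b) ≤ b' - b := mul_le_of_le_one_left (by linarith) hw₁
      have e : unitSpeedPolyline X (a + w * (a' - a)) - unitSpeedPolyline Y (b + w * (b' - b)) =
          (1 - w) * (unitSpeedPolyline X a - unitSpeedPolyline Y b) +
            w * (unitSpeedPolyline X a' - unitSpeedPolyline Y b') := by
        rw [unitSpeedPolyline_eq X (u := a) hka (by linarith),
          unitSpeedPolyline_eq X (u := a') (by linarith) hak,
          unitSpeedPolyline_eq Y (u := b) hlb (by linarith),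
          unitSpeedPolyline_eq Y (u := b') (by linarith) hbl,
          unitSpeedPolyline_eq X (k := k) (by linarith) (by linarith),
          unitSpeedPolyline_eq Y (k := l) (by linarith) (by linarith)]
        ring
      rw [e]
      rw [abs_le] at hr hr₀ ⊢
      constructor <;> nlinarith

theorem FrechetReachable.step_natCast {X Y : ℕ → ℝ} {r a b : ℝ}
    (h : FrechetReachable (unitSpeedPolyline X) (unitSpeedPolyline Y) r a b) {k l : ℕ}
    (hka : k ≤ a) (hak : a ≤ (k + 1 : ℕ)) (hlb : l ≤ b) (hbl : b ≤ (l + 1 : ℕ))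
    (hr : |X (k + 1) - Y (l + 1)| ≤ r) :
    FrechetReachable (unitSpeedPolyline X) (unitSpeedPolyline Y) r (k + 1 : ℕ) (l + 1 : ℕ) :=
  h.step hka hak (by push_cast; rfl) hlb hbl (by push_cast; rfl)
    (by rwa [unitSpeedPolyline_natCast, unitSpeedPolyline_natCast])

theorem frechetDist_le_of_reachable {X Y : List ℝ} {n : ℕ} (hn : 0 < n)
    (hX : X.length = n + 1) (hY : Y.length = n + 1) {r : ℝ}
    (h : FrechetReachable (unitSpeedPolyline fun k => X.getD k 0)
      (unitSpeedPolyline fun k => Y.getD k 0) r n n) :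
    frechetDist (polylineL X) (polylineL Y) ≤ r := by
  obtain ⟨T, φ, ψ, hT, hφ, hψ, mφ, mψ, φ0, ψ0, φT, ψT, hd⟩ := h
  have hn' : (0 : ℝ) < n := by exact_mod_cast hn
  have mono (χ : ℝ → ℝ) (hχ : Monotone χ) : Monotone fun t => χ (t * T) / n := by
    intro s t hst
    have := hχ (mul_le_mul_of_nonneg_right hst hT)
    dsimp only
    gcongr
  refine csInf_le ⟨0, ?_⟩ ⟨fun t => φ (t * T) / n, fun t => ψ (t * T) / n,
    (by fun_prop : Continuous _).continuousOn, (by fun_prop : Continuous _).continuousOn,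
    (mono φ mφ).monotoneOn _, (mono ψ mψ).monotoneOn _, by simp [φ0], by simp [φT, hn'.ne'],
    by simp [ψ0], by simp [ψT, hn'.ne'], ?_⟩
  · rintro r ⟨φ, ψ, -, -, -, -, -, -, -, -, h⟩
    exact dist_nonneg.trans (h 0 ⟨le_rfl, zero_le_one⟩)
  · rintro t ⟨ht₀, ht₁⟩
    have h₀ : 0 ≤ t * T := by positivity
    have h₁ : t * T ≤ T := mul_le_of_le_one_left hT ht₁
    have a₀ := mφ h₀
    have a₁ := mφ h₁
    have b₀ := mψ h₀
    have b₁ := mψ h₁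
    rw [φ0] at a₀
    rw [φT] at a₁
    rw [ψ0] at b₀
    rw [ψT] at b₁
    rw [polylineL_eq X hX hn (by positivity) ((div_le_one hn').2 a₁),
      polylineL_eq Y hY hn (by positivity) ((div_le_one hn').2 b₁),
      div_mul_cancel₀ _ hn'.ne', div_mul_cancel₀ _ hn'.ne', Real.dist_eq]
    exact hd _ ⟨h₀, h₁⟩

theorem le_frechetDist_of_forall {X Y : List ℝ} {n : ℕ} (hn : 0 < n)
    (hX : X.length = n + 1) (hY : Y.length = n + 1) {M : ℝ}
    (hXM : ∀ k ≤ n, X.getD k 0 ∈ Set.Icc 0 M) (hYM : ∀ k ≤ n, Y.getD k 0 ∈ Set.Icc 0 M) {c : ℝ}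
    (h : ∀ (r : ℝ) (φ ψ : ℝ → ℝ), ContinuousOn φ (Set.Icc 0 1) → MonotoneOn φ (Set.Icc 0 1) →
      MonotoneOn ψ (Set.Icc 0 1) → φ 0 = 0 → φ 1 = n → ψ 0 = 0 → ψ 1 = n →
      (∀ t ∈ Set.Icc (0 : ℝ) 1, |unitSpeedPolyline (fun k => X.getD k 0) (φ t) -
        unitSpeedPolyline (fun k => Y.getD k 0) (ψ t)| ≤ r) → c ≤ r) :
    c ≤ frechetDist (polylineL X) (polylineL Y) := by
  have mem {l : List ℝ} (hl : l.length = n + 1) (hM : ∀ k ≤ n, l.getD k 0 ∈ Set.Icc 0 M)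
      {t : ℝ} (ht : t ∈ Set.Icc (0 : ℝ) 1) : polylineL l t ∈ Set.Icc 0 M := by
    rw [polylineL_eq l hl hn ht.1 ht.2]
    exact unitSpeedPolyline_mem _ (convex_Icc 0 M) (p := 0) (q := n) (fun k _ hk => hM k hk)
      (by simpa using mul_nonneg ht.1 n.cast_nonneg)
      (mul_le_of_le_one_left n.cast_nonneg ht.2)
  refine le_csInf ⟨M, id, id, continuousOn_id, continuousOn_id, monotoneOn_id, monotoneOn_id,
    rfl, rfl, rfl, rfl, fun t ht => ?_⟩ ?_
  · have hx := mem hX hXM ht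
    have hy := mem hY hYM ht
    rw [id, Real.dist_eq, abs_le]
    constructor <;> linarith [hx.1, hx.2, hy.1, hy.2]
  · rintro r ⟨φ, ψ, cφ, -, mφ, mψ, φ0, φ1, ψ0, ψ1, hd⟩
    have scale (χ : ℝ → ℝ) (hχ : MonotoneOn χ (Set.Icc 0 1)) :
        MonotoneOn (fun t => χ t * n) (Set.Icc 0 1) := fun s hs t ht hst =>
      mul_le_mul_of_nonneg_right (hχ hs ht hst) n.cast_nonneg
    refine h r (fun t => φ t * n) (fun t => ψ t * n) (by fun_prop) (scale φ mφ) (scale ψ mψ)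
      (by simp [φ0]) (by simp [φ1]) (by simp [ψ0]) (by simp [ψ1]) fun t ht => ?_
    have range (χ : ℝ → ℝ) (hχ : MonotoneOn χ (Set.Icc 0 1)) (h0 : χ 0 = 0) (h1 : χ 1 = 1) :
        0 ≤ χ t ∧ χ t ≤ 1 :=
      ⟨h0 ▸ hχ (by simp) ht ht.1, h1 ▸ hχ ht (by simp) ht.2⟩
    have := hd t ht
    rwa [polylineL_eq X hX hn (range φ mφ φ0 φ1).1 (range φ mφ φ0 φ1).2,
      polylineL_eq Y hY hn (range ψ mψ ψ0 ψ1).1 (range ψ mψ ψ0 ψ1).2, Real.dist_eq] at this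

section PairList

variable {α : Type*} (f g : ℕ → α)

theorem length_flatMap_pair (U : ℕ) :
    ((List.range U).flatMap fun j => [f j, g j]).length = 2 * U := by
  simp [List.length_flatMap, mul_comm]

theorem getD_flatMap_pair {U j : ℕ} (hj : j < U) (d : α) :
    ((List.range U).flatMap fun j => [f j, g j]).getD (2 * j) d = f j ∧
    ((List.range U).flatMap fun j => [f j, g j]).getD (2 * j + 1) d = g j := by
  induction U with
  | zero => omega
  | succ U ih =>
    rw [List.range_succ, List.flatMap_append]
    have hlen := length_flatMap_pair f g U
    rcases (Nat.lt_succ_iff.1 hj).lt_or_eq with h | rfl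
    · rw [List.getD_append _ _ _ _ (by omega), List.getD_append _ _ _ _ (by omega)]
      exact ih h
    · rw [List.getD_append_right _ _ _ _ (by omega), List.getD_append_right _ _ _ _ (by omega),
        hlen]
      simp

theorem length_pairList (a z : α) (U : ℕ) :
    ((a :: (List.range U).flatMap fun j => [f j, g j]) ++ [z]).length = 2 * U + 1 + 1 := by
  rw [List.length_append, List.length_cons, length_flatMap_pair, List.length_singleton]

theorem getD_pairList_last (a z d : α) (U : ℕ) :
    ((a :: (List.range U).flatMap fun j => [f j, g j]) ++ [z]).getD (2 * U + 1) d = z := by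
  have hlen : (a :: (List.range U).flatMap fun j => [f j, g j]).length = 2 * U + 1 := by
    rw [List.length_cons, length_flatMap_pair]
  rw [List.getD_append_right _ _ _ _ hlen.le, hlen]
  simp

theorem getD_pairList_odd (a z d : α) {U j : ℕ} (hj : j < U) :
    ((a :: (List.range U).flatMap fun j => [f j, g j]) ++ [z]).getD (2 * j + 1) d = f j := by
  rw [List.getD_append _ _ _ _ (by rw [List.length_cons, length_flatMap_pair]; omega),
    List.getD_cons_succ]
  exact (getD_flatMap_pair f g hj d).1

theorem getD_pairList_even (a z d : α) {U j : ℕ} (hj : j < U) :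
    ((a :: (List.range U).flatMap fun j => [f j, g j]) ++ [z]).getD (2 * j + 2) d = g j := by
  rw [List.getD_append _ _ _ _ (by rw [List.length_cons, length_flatMap_pair]; omega),
    List.getD_cons_succ]
  exact (getD_flatMap_pair f g hj d).2

end PairList

theorem xlist_eq (U : ℕ) (A : Finset ℕ) :
    xlist U A = ((0 : ℝ) :: (List.range U).flatMap fun j : ℕ =>
      [if j + 1 ∈ A then 4 * (j : ℝ) + 8 else 4 * j + 4, 4 * (j : ℝ) + 4]) ++ [4 * (U : ℝ) + 5] := by
  unfold xlist
  congr! 4 with j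
  · split_ifs <;> push_cast <;> ring_nf
  · push_cast; rfl

theorem ylist_eq (U : ℕ) (B : Finset ℕ) :
    ylist U B = ((0 : ℝ) :: (List.range U).flatMap fun j : ℕ =>
      [if j + 1 ∈ B then 4 * (j : ℝ) + 4 else 4 * j + 7,
        if j + 1 ∈ B then 4 * (j : ℝ) + 4 else 4 * j + 5]) ++ [4 * (U : ℝ) + 5] := by
  unfold ylist
  congr! 4 with j
  · split_ifs <;> push_cast <;> ring_nf
  · push_cast; rfl

theorem length_xlist (U : ℕ) (A : Finset ℕ) : (xlist U A).length = 2 * U + 1 + 1 := by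
  rw [xlist_eq, length_pairList]

theorem length_ylist (U : ℕ) (B : Finset ℕ) : (ylist U B).length = 2 * U + 1 + 1 := by
  rw [ylist_eq, length_pairList]

theorem getD_xlist_zero (U : ℕ) (A : Finset ℕ) : (xlist U A).getD 0 0 = 0 := by
  simp [xlist_eq]

theorem getD_ylist_zero (U : ℕ) (B : Finset ℕ) : (ylist U B).getD 0 0 = 0 := by
  simp [ylist_eq]

theorem getD_xlist_last (U : ℕ) (A : Finset ℕ) :
    (xlist U A).getD (2 * U + 1) 0 = 4 * U + 5 := by
  rw [xlist_eq, getD_pairList_last]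

theorem getD_ylist_last (U : ℕ) (B : Finset ℕ) :
    (ylist U B).getD (2 * U + 1) 0 = 4 * U + 5 := by
  rw [ylist_eq, getD_pairList_last]

theorem getD_xlist_odd {U j : ℕ} (A : Finset ℕ) (hj : j < U) :
    (xlist U A).getD (2 * j + 1) 0 = if j + 1 ∈ A then 4 * (j : ℝ) + 8 else 4 * j + 4 := by
  rw [xlist_eq, getD_pairList_odd _ _ _ _ _ hj]

theorem getD_xlist_even {U j : ℕ} (A : Finset ℕ) (hj : j < U) :
    (xlist U A).getD (2 * j + 2) 0 = 4 * j + 4 := by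
  rw [xlist_eq, getD_pairList_even _ _ _ _ _ hj]

theorem getD_ylist_odd {U j : ℕ} (B : Finset ℕ) (hj : j < U) :
    (ylist U B).getD (2 * j + 1) 0 = if j + 1 ∈ B then 4 * (j : ℝ) + 4 else 4 * j + 7 := by
  rw [ylist_eq, getD_pairList_odd _ _ _ _ _ hj]

theorem getD_ylist_even {U j : ℕ} (B : Finset ℕ) (hj : j < U) :
    (ylist U B).getD (2 * j + 2) 0 = if j + 1 ∈ B then 4 * (j : ℝ) + 4 else 4 * j + 5 := by
  rw [ylist_eq, getD_pairList_even _ _ _ _ _ hj]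

/-- A property of all vertices of a gadget follows from the four kinds of vertices. -/
theorem forall_le_of_parity {U : ℕ} {P : ℕ → Prop} (h0 : P 0) (hlast : P (2 * U + 1))
    (hodd : ∀ j < U, P (2 * j + 1)) (heven : ∀ j < U, P (2 * j + 2)) :
    ∀ k ≤ 2 * U + 1, P k := by
  intro k hk
  rcases Nat.even_or_odd' k with ⟨j, rfl | rfl⟩
  · rcases j with _ | j
    · exact h0
    · exact heven j (by omega)
  · rcases (by omega : j < U ∨ j = U) with h | rfl
    · exact hodd j h
    · exact hlast

theorem getD_xlist_mem (U : ℕ) (A : Finset ℕ) :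
    ∀ k ≤ 2 * U + 1, (xlist U A).getD k 0 ∈ Set.Icc (0 : ℝ) (4 * U + 8) := by
  have hU : (0 : ℝ) ≤ U := U.cast_nonneg
  refine forall_le_of_parity ?_ ?_ (fun j hj => ?_) fun j hj => ?_
  · rw [getD_xlist_zero]; constructor <;> linarith
  · rw [getD_xlist_last]; constructor <;> linarith
  all_goals
    have hj' : (j : ℝ) + 1 ≤ U := by exact_mod_cast hj
    have hj₀ : (0 : ℝ) ≤ j := j.cast_nonneg
  · rw [getD_xlist_odd A hj]; split_ifs <;> constructor <;> linarith
  · rw [getD_xlist_even A hj]; constructor <;> linarith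

theorem getD_ylist_mem (U : ℕ) (B : Finset ℕ) :
    ∀ k ≤ 2 * U + 1, (ylist U B).getD k 0 ∈ Set.Icc (0 : ℝ) (4 * U + 8) := by
  have hU : (0 : ℝ) ≤ U := U.cast_nonneg
  refine forall_le_of_parity ?_ ?_ (fun j hj => ?_) fun j hj => ?_
  · rw [getD_ylist_zero]; constructor <;> linarith
  · rw [getD_ylist_last]; constructor <;> linarith
  all_goals
    have hj' : (j : ℝ) + 1 ≤ U := by exact_mod_cast hj
    have hj₀ : (0 : ℝ) ≤ j := j.cast_nonneg
  · rw [getD_ylist_odd B hj]; split_ifs <;> constructor <;> linarith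
  · rw [getD_ylist_even B hj]; split_ifs <;> constructor <;> linarith

theorem getD_ylist_le {U j : ℕ} {B : Finset ℕ} (hj : j < U) (hB : j + 1 ∈ B) :
    ∀ k ≤ 2 * j + 2, (ylist U B).getD k 0 ≤ 4 * j + 4 := by
  have hj₀ : (0 : ℝ) ≤ j := j.cast_nonneg
  intro k hk
  refine forall_le_of_parity (U := U)
    (P := fun k => k ≤ 2 * j + 2 → (ylist U B).getD k 0 ≤ 4 * j + 4) ?_ (fun h => by omega)
    (fun i hi hij => ?_) (fun i hi hij => ?_) k (by omega) hk
  · intro; rw [getD_ylist_zero]; linarith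
  · rw [getD_ylist_odd B hi]
    rcases (by omega : i = j ∨ i + 1 ≤ j) with rfl | h
    · rw [if_pos hB]
    · have : (i : ℝ) + 1 ≤ j := by exact_mod_cast h
      split_ifs <;> linarith
  · rw [getD_ylist_even B hi]
    rcases (by omega : i = j ∨ i + 1 ≤ j) with rfl | h
    · rw [if_pos hB]
    · have : (i : ℝ) + 1 ≤ j := by exact_mod_cast h
      split_ifs <;> linarith

theorem le_getD_ylist {U j : ℕ} (B : Finset ℕ) (hj : j < U) :
    ∀ k, 2 * j + 3 ≤ k → k ≤ 2 * U + 1 → 4 * (j : ℝ) + 8 ≤ (ylist U B).getD k 0 := by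
  intro k hk hkU
  refine forall_le_of_parity (U := U)
    (P := fun k => 2 * j + 3 ≤ k → 4 * (j : ℝ) + 8 ≤ (ylist U B).getD k 0) (fun h => by omega) ?_
    (fun i hi hij => ?_) (fun i hi hij => ?_) k hkU hk
  · intro
    have : (j : ℝ) + 1 ≤ U := by exact_mod_cast hj
    rw [getD_ylist_last]; linarith
  · have : (j : ℝ) + 1 ≤ i := by exact_mod_cast (by omega : j + 1 ≤ i)
    rw [getD_ylist_odd B hi]
    split_ifs <;> linarith
  · have : (j : ℝ) + 1 ≤ i := by exact_mod_cast (by omega : j + 1 ≤ i)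
    rw [getD_ylist_even B hi]
    split_ifs <;> linarith

theorem reachable_initial_gadgets {U : ℕ} {A B : Finset ℕ} (hAB : Disjoint A B) {k : ℕ}
    (hk : k ≤ U) :
    ∃ a : ℝ, (2 * k : ℕ) ≤ a ∧ a ≤ (2 * k + 1 : ℕ) ∧
      FrechetReachable (unitSpeedPolyline fun k => (xlist U A).getD k 0)
        (unitSpeedPolyline fun k => (ylist U B).getD k 0) 1 a (2 * k : ℕ) := by
  induction k with
  | zero =>
    refine ⟨0, by simp, by simp, ?_⟩
    have hx := unitSpeedPolyline_natCast (fun k => (xlist U A).getD k 0) 0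
    have hy := unitSpeedPolyline_natCast (fun k => (ylist U B).getD k 0) 0
    rw [Nat.cast_zero] at hx hy
    simp only [mul_zero, Nat.cast_zero]
    apply FrechetReachable.zero
    rw [hx, hy, getD_xlist_zero, getD_ylist_zero]
    simp
  | succ k ih =>
    obtain ⟨a, ha₁, ha₂, hr⟩ := ih (by omega)
    have hkU : k < U := hk
    have xo := getD_xlist_odd A hkU
    have xe := getD_xlist_even A hkU
    have yo := getD_ylist_odd B hkU
    have ye := getD_ylist_even B hkU
    by_cases hmem : k + 1 ∈ A ∨ k + 1 ∈ B
    · refine ⟨(2 * k + 1 + 1 : ℕ), le_rfl, by push_cast; linarith, ?_⟩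
      have h : ¬ (k + 1 ∈ A ∧ k + 1 ∈ B) := fun h => Finset.disjoint_left.1 hAB h.1 h.2
      refine (hr.step_natCast ha₁ ha₂ le_rfl (Nat.cast_le.2 (Nat.le_succ _)) ?_).step_natCast
        (k := 2 * k + 1) (l := 2 * k + 1) le_rfl (Nat.cast_le.2 (Nat.le_succ _)) le_rfl
        (Nat.cast_le.2 (Nat.le_succ _)) ?_
      · rw [xo, yo, abs_le]
        split_ifs <;> first | tauto | constructor <;> linarith
      · rw [xe, ye, abs_le]
        split_ifs <;> first | tauto | constructor <;> linarith
    · push Not at hmem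
      rw [if_neg hmem.1] at xo
      rw [if_neg hmem.2] at yo ye
      have y0 : (ylist U B).getD (2 * k) 0 ≤ 4 * k + 4 := by
        rcases k with _ | k
        · rw [mul_zero, getD_ylist_zero]; norm_num
        · rw [mul_add_one, getD_ylist_even B (by omega : k < U)]
          split_ifs <;> push_cast <;> linarith
      have x3 : 4 * (k : ℝ) + 6 ≤ (xlist U A).getD (2 * k + 2 + 1) 0 := by
        rcases (by omega : k + 1 < U ∨ U = k + 1) with h | rfl
        · rw [show 2 * k + 2 + 1 = 2 * (k + 1) + 1 by ring, getD_xlist_odd A h]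
          split_ifs <;> push_cast <;> linarith
        · rw [show 2 * k + 2 + 1 = 2 * (k + 1) + 1 by ring, getD_xlist_last]
          push_cast
          linarith
      obtain ⟨b, hb₁, hb₂, hb⟩ := exists_unitSpeedPolyline_eq (fun k => (ylist U B).getD k 0)
        (k := 2 * k) (v := 4 * k + 4) y0 (by linarith)
      obtain ⟨c, hc₁, hc₂, hc⟩ := exists_unitSpeedPolyline_eq (fun k => (xlist U A).getD k 0)
        (k := 2 * k + 2) (v := 4 * k + 6) (by linarith) x3
      have X1 := unitSpeedPolyline_natCast (fun k => (xlist U A).getD k 0) (2 * k + 1)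
      have X2 := unitSpeedPolyline_natCast (fun k => (xlist U A).getD k 0) (2 * k + 2)
      have Y1 := unitSpeedPolyline_natCast (fun k => (ylist U B).getD k 0) (2 * k + 1)
      have Y2 := unitSpeedPolyline_natCast (fun k => (ylist U B).getD k 0) (2 * k + 2)
      have r₁ := hr.step (a' := (2 * k + 1 : ℕ)) (b' := b) ha₁ ha₂ (by push_cast; rfl) le_rfl
        hb₁ hb₂
        (by rw [X1, hb, xo]; simp)
      have r₂ := r₁.step (a' := (2 * k + 2 : ℕ)) (b' := b) le_rfl (by push_cast; linarith)
        (by push_cast; linarith) hb₁ le_rfl hb₂ (by rw [X2, hb, xe]; simp)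
      have r₃ := r₂.step (a' := c) (b' := (2 * k + 1 : ℕ)) le_rfl hc₁ hc₂ hb₁
        (by push_cast at hb₂ ⊢; exact hb₂) (by push_cast; rfl)
        (by rw [hc, Y1, yo, abs_le]; constructor <;> linarith)
      have r₄ := r₃.step (a' := c) (b' := (2 * k + 2 : ℕ)) hc₁ le_rfl hc₂ le_rfl
        (by push_cast; linarith) (by push_cast; linarith)
        (by rw [hc, Y2, ye, abs_le]; constructor <;> linarith)
      exact ⟨c, hc₁, by push_cast at hc₂ ⊢; linarith, r₄⟩

theorem frechetDist_gadget_le_one {U : ℕ} {A B : Finset ℕ} (hAB : Disjoint A B) :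
    frechetDist (polylineL (xlist U A)) (polylineL (ylist U B)) ≤ 1 := by
  obtain ⟨a, ha₁, ha₂, hr⟩ := reachable_initial_gadgets hAB (le_refl U)
  refine frechetDist_le_of_reachable (Nat.succ_pos _) (length_xlist U A) (length_ylist U B)
    (hr.step_natCast ha₁ ha₂ le_rfl (by push_cast; linarith) ?_)
  rw [getD_xlist_last, getD_ylist_last]
  simp

theorem two_le_frechetDist_gadget {U j : ℕ} {A B : Finset ℕ} (hj : j < U) (hA : j + 1 ∈ A)
    (hB : j + 1 ∈ B) :
    2 ≤ frechetDist (polylineL (xlist U A)) (polylineL (ylist U B)) := by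
  refine le_frechetDist_of_forall (Nat.succ_pos _) (length_xlist U A) (length_ylist U B)
    (getD_xlist_mem U A) (getD_ylist_mem U B) ?_
  intro r φ ψ cφ mφ mψ φ0 φ1 ψ0 ψ1 hd
  by_contra! hr
  have hjU : (j : ℝ) + 1 ≤ U := by exact_mod_cast hj
  have hj₀ : (0 : ℝ) ≤ j := j.cast_nonneg
  have ivt := intermediate_value_Icc zero_le_one cφ
  rw [φ0, φ1] at ivt
  obtain ⟨s, hs, hφs⟩ := ivt (show ((2 * j + 1 : ℕ) : ℝ) ∈ _ by
    push_cast; constructor <;> linarith)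
  obtain ⟨t, ht, hφt⟩ := ivt (show ((2 * j + 2 : ℕ) : ℝ) ∈ _ by
    push_cast; constructor <;> linarith)
  have hst : s ≤ t := by
    by_contra! h
    have := mφ ht hs h.le
    rw [hφs, hφt] at this
    push_cast at this
    linarith
  have hψ := mψ hs ht hst
  have hψs : 0 ≤ ψ s := ψ0 ▸ mψ (by simp) hs hs.1
  have hψt : ψ t ≤ (2 * U + 1 : ℕ) := ψ1 ▸ mψ ht (by simp) ht.2
  have hds := abs_le.1 (hd s hs)
  have hdt := abs_le.1 (hd t ht)
  rw [hφs, unitSpeedPolyline_natCast, getD_xlist_odd A hj, if_pos hA] at hds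
  rw [hφt, unitSpeedPolyline_natCast, getD_xlist_even A hj] at hdt
  have h₁ : ((2 * j + 2 : ℕ) : ℝ) < ψ s := by
    by_contra! h
    have := unitSpeedPolyline_mem (fun k => (ylist U B).getD k 0)
      (convex_Iic (4 * (j : ℝ) + 4)) (p := 0) (fun k _ hk => getD_ylist_le hj hB k hk)
      (by simpa using hψs) h
    rw [Set.mem_Iic] at this
    linarith
  have h₂ : ψ t < ((2 * j + 3 : ℕ) : ℝ) := by
    by_contra! h
    have := unitSpeedPolyline_mem (fun k => (ylist U B).getD k 0)
      (convex_Ici (4 * (j : ℝ) + 8)) (fun k hk hk' => le_getD_ylist B hj k hk hk') h hψt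
    rw [Set.mem_Ici] at this
    linarith
  have h₃ : ((2 * j + 3 : ℕ) : ℝ) = (2 * j + 2 : ℕ) + 1 := by push_cast; ring
  rw [h₃] at h₂
  have ye := getD_ylist_le hj hB (2 * j + 2) le_rfl
  have yo := le_getD_ylist B hj (2 * j + 3) le_rfl (by omega)
  rw [unitSpeedPolyline_eq _ h₁.le (by linarith)] at hds
  rw [unitSpeedPolyline_eq _ (by linarith) h₂.le] at hdt
  nlinarith

/-- the reduction gadgets have Fréchet distance at most 1 iff the sets are
disjoint, and at least 2 otherwise. -/
theorem disjointness_reduction (U : ℕ) (A B : Finset ℕ)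
    (hA : A ⊆ Finset.Icc 1 U) (hB : B ⊆ Finset.Icc 1 U) :
    (A ∩ B = ∅ → frechetDist (polylineL (xlist U A)) (polylineL (ylist U B)) ≤ 1) ∧
    ((A ∩ B).Nonempty →
      2 ≤ frechetDist (polylineL (xlist U A)) (polylineL (ylist U B))) := by
  refine ⟨fun h => frechetDist_gadget_le_one (Finset.disjoint_iff_inter_eq_empty.2 h), ?_⟩
  rintro ⟨i, hi⟩
  obtain ⟨hiA, hiB⟩ := Finset.mem_inter.1 hi
  obtain ⟨h₁, h₂⟩ := Finset.mem_Icc.1 (hA hiA)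
  obtain ⟨j, rfl⟩ := Nat.exists_eq_add_of_le' h₁
  exact two_le_frechetDist_gadget h₂ hiA hiB
end
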